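/- Let l ≥ 2, let ε_k → 0 with ε_k > 0, and let u_k : B_1 → ℝ^l be smooth sphere-valued ε_k-harmonic maps with sup_k ∫_{B_1} (|∇u_k|² + ε_k |Δu_k|²) dx < ∞. Let r_k → 0 with r_k > 0 and let ω : ℝ² → ℝ^l be a smooth nonconstant map with 0 < ∫_{ℝ²} |Δω|² dx < ∞ such that v_k(y) = u_k(r_k y) converge to ω in C³ on every compact subset of ℝ². Assume the single-bubble neck condition: for every δ > 0 there exist R ≥ 1, R₀ ∈ (0,1) and K such that for all k ≥ K, (a) |∇^t u_k(x)| ≤ √δ |x|^{−t} for t ∈ {1,2,3} and all x with 2Rr_k ≤ |x| ≤ R₀/4, and (b) ∫_{A(a,2a)} (|∇u_k|² + ε_k |Δu_k|²) dx ≤ δ for every a with Rr_k < a < R₀/2. If ν = lim_{k→∞} (ε_k / r_k²)^{1/2} log(1/r_k) = 0, then no neck forms: lim_{R₀→0} lim_{R→∞} lim_{k→∞} sup { |u_k(x) − u_k(y)| : R r_k ≤ |x| ≤ R₀, R r_k ≤ |y| ≤ R₀ } = 0, in the sense that the iterated limit of the limsup in k is 0. -/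

import Mathlib

open scoped RealInnerProductSpace
open Filter MeasureTheory Metric

noncomputable section

/-- The plane `ℝ²` as a Euclidean space. -/
abbrev E2 : Type := EuclideanSpace ℝ (Fin 2)

/-- Euclidean space `ℝ^l`. -/
abbrev Eu (l : ℕ) : Type := EuclideanSpace ℝ (Fin l)

/-- Partial derivative `∂_α u` of a map `u : ℝ² → ℝ^l`. -/
def pd {l : ℕ} (α : Fin 2) (u : E2 → Eu l) (x : E2) : Eu l :=
  fderiv ℝ u x (EuclideanSpace.single α 1)

/-- Partial derivative `∂_α f` of a scalar function `f : ℝ² → ℝ`. -/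
def pds (α : Fin 2) (f : E2 → ℝ) (x : E2) : ℝ :=
  fderiv ℝ f x (EuclideanSpace.single α 1)

/-- The componentwise Laplacian `Δu = ∂₁∂₁u + ∂₂∂₂u`. -/
def lap {l : ℕ} (u : E2 → Eu l) (x : E2) : Eu l :=
  pd 0 (pd 0 u) x + pd 1 (pd 1 u) x

/-- `|∇u|² = |∂₁u|² + |∂₂u|²`. -/
def gradSq {l : ℕ} (u : E2 → Eu l) (x : E2) : ℝ :=
  ‖pd 0 u x‖ ^ 2 + ‖pd 1 u x‖ ^ 2

/-- The harmonic stress-energy tensor `S¹_{αβ}(u) = ½|∇u|²δ_{αβ} − ⟨∂_α u, ∂_β u⟩`. -/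
def S1 {l : ℕ} (u : E2 → Eu l) (α β : Fin 2) (x : E2) : ℝ :=
  (1 / 2) * gradSq u x * (if α = β then 1 else 0) - ⟪pd α u x, pd β u x⟫

/-- Jiang's biharmonic stress-energy tensor
`S²_{αβ}(u) = ½|Δu|²δ_{αβ} + ∑_γ ⟨∂_γ u, ∂_γ Δu⟩ δ_{αβ} − ⟨∂_α u, ∂_β Δu⟩ − ⟨∂_β u, ∂_α Δu⟩`. -/
def S2 {l : ℕ} (u : E2 → Eu l) (α β : Fin 2) (x : E2) : ℝ :=
  (1 / 2) * ‖lap u x‖ ^ 2 * (if α = β then 1 else 0)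
    + (∑ γ : Fin 2, ⟪pd γ u x, pd γ (lap u) x⟫) * (if α = β then 1 else 0)
    - ⟪pd α u x, pd β (lap u) x⟫ - ⟪pd β u x, pd α (lap u) x⟫

/-- A sphere-valued map `u : Ω → S^{l-1} ⊂ ℝ^l` is `ε`-harmonic if `Δu − εΔ²u` is a real
scalar multiple of `u` at every point of `Ω` (the Euler–Lagrange equation of the ε-energy). -/
def IsEpsHarmonic {l : ℕ} (ε : ℝ) (Ω : Set E2) (u : E2 → Eu l) : Prop :=
  ∀ x ∈ Ω, ∃ c : ℝ, lap u x - ε • lap (lap u) x = c • u x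

/-- The point `(a, b) ∈ ℝ²`. -/
def pt (a b : ℝ) : E2 := (WithLp.equiv 2 (Fin 2 → ℝ)).symm ![a, b]

/-- The radial derivative `∂_r u(x) = Du(x)[x/|x|]`. -/
def radialDeriv {l : ℕ} (u : E2 → Eu l) (x : E2) : Eu l :=
  fderiv ℝ u x (‖x‖⁻¹ • x)

/-- The angular derivative `∂_θ u(x) = Du(x)[(-x₂, x₁)]`, so that
`|∇u|² = |∂_r u|² + |x|⁻²|∂_θ u|²`. -/
def angularDeriv {l : ℕ} (u : E2 → Eu l) (x : E2) : Eu l :=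
  fderiv ℝ u x (pt (-(x 1)) (x 0))

/-- The circle integral `∫_{∂B_t} f dS = ∫₀^{2π} f(t cos θ, t sin θ) t dθ`. -/
def circInt (t : ℝ) (f : E2 → ℝ) : ℝ :=
  ∫ θ in (0:ℝ)..(2 * Real.pi), f (pt (t * Real.cos θ) (t * Real.sin θ)) * t

/-- The open annulus `A(p,q) = {x ∈ ℝ² : p < |x| < q}`. -/
def ann (p q : ℝ) : Set E2 := {x : E2 | p < ‖x‖ ∧ ‖x‖ < q}

/-- The `ε`-energy density `|∇u|² + ε|Δu|²`. -/
def eDen {l : ℕ} (ε : ℝ) (u : E2 → Eu l) (x : E2) : ℝ :=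
  gradSq u x + ε * ‖lap u x‖ ^ 2

/-- The derivative of `F` in the constant direction `v`. -/
def dirD {E V : Type*} [NormedAddCommGroup E] [NormedSpace ℝ E]
    [NormedAddCommGroup V] [NormedSpace ℝ V] (v : E) (F : E → V) (p : E) : V :=
  fderiv ℝ F p v

section DirectionalDerivative

variable {E V : Type*} [NormedAddCommGroup E] [NormedSpace ℝ E]
  [NormedAddCommGroup V] [InnerProductSpace ℝ V]

@[fun_prop]
lemma contDiff_dirD {v : E} {F : E → V} (hF : ContDiff ℝ (⊤ : ℕ∞) F) :
    ContDiff ℝ (⊤ : ℕ∞) (dirD v F) :=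
  (hF.fderiv_right (m := (⊤ : ℕ∞)) (by simp)).clm_apply contDiff_const

lemma dirD_comm {F : E → V} (hF : ContDiff ℝ (⊤ : ℕ∞) F) (v w : E) :
    dirD v (dirD w F) = dirD w (dirD v F) := by
  funext p
  have key : ∀ a b : E, dirD a (dirD b F) p = fderiv ℝ (fderiv ℝ F) p a b := by
    intro a b
    have h : DifferentiableAt ℝ (fderiv ℝ F) p :=
      (hF.fderiv_right (m := (⊤ : ℕ∞)) (by simp)).differentiable (by simp) p
    change fderiv ℝ (fun q => fderiv ℝ F q b) p a = _
    rw [fderiv_clm_apply h (differentiableAt_const b)]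
    simp
  rw [key, key]
  have hs : minSmoothness ℝ 2 ≤ ((⊤ : ℕ∞) : WithTop ℕ∞) := by
    rw [minSmoothness_of_isRCLikeNormedField]
    exact WithTop.coe_le_coe.2 (le_top : (2 : ℕ∞) ≤ ⊤)
  exact (hF.contDiffAt.isSymmSndFDerivAt hs) v w

lemma ContDiff.diffAt {F : E → V} (hF : ContDiff ℝ (⊤ : ℕ∞) F) (p : E) :
    DifferentiableAt ℝ F p := hF.differentiable (by simp) p

lemma dirD_inner {A B : E → V} (hA : ContDiff ℝ (⊤ : ℕ∞) A) (hB : ContDiff ℝ (⊤ : ℕ∞) B)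
    (v p : E) : dirD v (fun q => ⟪A q, B q⟫) p = ⟪A p, dirD v B p⟫ + ⟪dirD v A p, B p⟫ :=
  fderiv_inner_apply ℝ (hA.diffAt p) (hB.diffAt p) v

lemma dirD_add {A B : E → V} (hA : ContDiff ℝ (⊤ : ℕ∞) A) (hB : ContDiff ℝ (⊤ : ℕ∞) B)
    (v p : E) : dirD v (fun q => A q + B q) p = dirD v A p + dirD v B p := by
  simp only [dirD]
  rw [fderiv_fun_add (hA.diffAt p) (hB.diffAt p)]
  rfl

lemma dirD_smul {a : E → ℝ} {B : E → V} (ha : ContDiff ℝ (⊤ : ℕ∞) a)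
    (hB : ContDiff ℝ (⊤ : ℕ∞) B) (v p : E) :
    dirD v (fun q => a q • B q) p = a p • dirD v B p + dirD v a p • B p := by
  simp only [dirD]
  rw [fderiv_fun_smul (ha.diffAt p) (hB.diffAt p)]
  simp

lemma dirD_congr {A B : E → V} {p : E} (h : A =ᶠ[nhds p] B) (v : E) :
    dirD v A p = dirD v B p := by
  simp only [dirD, h.fderiv_eq]

lemma norm_iteratedFDeriv_dirD_le {F : E → V} (hF : ContDiff ℝ (⊤ : ℕ∞) F) {v : E}
    (hv : ‖v‖ ≤ 1) (n : ℕ) (p : E) :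
    ‖iteratedFDeriv ℝ n (dirD v F) p‖ ≤ ‖iteratedFDeriv ℝ (n + 1) F p‖ := by
  have h := norm_iteratedFDeriv_clm_apply_const (c := v) (n := n) (x := p)
    ((hF.fderiv_right (m := (⊤ : ℕ∞)) (by simp)).contDiffAt) (by exact_mod_cast le_top)
  rw [norm_iteratedFDeriv_fderiv] at h
  refine h.trans ?_
  have := norm_nonneg (iteratedFDeriv ℝ (n + 1) F p)
  nlinarith

end DirectionalDerivative

section CircleMean

variable {V : Type*} [NormedAddCommGroup V] [InnerProductSpace ℝ V]

/-- The integral of `F(s, ·)` over the circle `[0, 2π]`. -/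
def angInt (F : ℝ × ℝ → V) (s : ℝ) : V := ∫ θ in (0 : ℝ)..(2 * Real.pi), F (s, θ)

lemma hasDerivAt_fst {F : ℝ × ℝ → V} (hF : ContDiff ℝ (⊤ : ℕ∞) F) (s θ : ℝ) :
    HasDerivAt (fun x => F (x, θ)) (dirD (1, 0) F (s, θ)) s := by
  have h1 := (hF.diffAt (s, θ)).hasFDerivAt
  have h2 : HasDerivAt (fun x : ℝ => (x, θ)) ((1 : ℝ), (0 : ℝ)) s :=
    (hasDerivAt_id s).prodMk (hasDerivAt_const s θ)
  exact h1.comp_hasDerivAt s h2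

lemma hasDerivAt_snd {F : ℝ × ℝ → V} (hF : ContDiff ℝ (⊤ : ℕ∞) F) (s θ : ℝ) :
    HasDerivAt (fun x => F (s, x)) (dirD (0, 1) F (s, θ)) θ := by
  have h1 := (hF.diffAt (s, θ)).hasFDerivAt
  have h2 : HasDerivAt (fun x : ℝ => (s, x)) ((0 : ℝ), (1 : ℝ)) θ :=
    (hasDerivAt_const θ s).prodMk (hasDerivAt_id θ)
  exact h1.comp_hasDerivAt θ h2

lemma continuous_slice {V : Type*} [TopologicalSpace V] {F : ℝ × ℝ → V} (hF : Continuous F) (s : ℝ) :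
    Continuous fun θ => F (s, θ) := by fun_prop

lemma hasDerivAt_angInt [CompleteSpace V] {F : ℝ × ℝ → V} (hF : ContDiff ℝ (⊤ : ℕ∞) F) (s : ℝ) :
    HasDerivAt (angInt F) (angInt (dirD (1, 0) F) s) s := by
  have hD : ContDiff ℝ (⊤ : ℕ∞) (dirD (1, 0) F) := contDiff_dirD hF
  have hK : IsCompact (Set.Icc (s - 1) (s + 1) ×ˢ Set.uIcc 0 (2 * Real.pi)) :=
    isCompact_Icc.prod isCompact_uIcc
  obtain ⟨C, hC⟩ := hK.exists_bound_of_continuousOn hD.continuous.continuousOn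
  refine (intervalIntegral.hasDerivAt_integral_of_dominated_loc_of_deriv_le
    (F := fun x θ => F (x, θ)) (F' := fun x θ => dirD (1, 0) F (x, θ)) (bound := fun _ => C)
    (Icc_mem_nhds (by linarith : s - 1 < s) (by linarith : s < s + 1)) ?_ ?_ ?_ ?_ ?_ ?_).2
  · exact Eventually.of_forall fun x =>
      (continuous_slice hF.continuous x).aestronglyMeasurable
  · exact (continuous_slice hF.continuous s).intervalIntegrable _ _
  · exact (continuous_slice hD.continuous s).aestronglyMeasurable
  · exact Eventually.of_forall fun θ hθ x hx => hC _ ⟨hx, Set.uIoc_subset_uIcc hθ⟩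
  · exact intervalIntegrable_const
  · exact Eventually.of_forall fun θ _ x _ => hasDerivAt_fst hF x θ

lemma angInt_dirD_snd [CompleteSpace V] {F : ℝ × ℝ → V} (hF : ContDiff ℝ (⊤ : ℕ∞) F)
    (hper : ∀ s θ, F (s, θ + 2 * Real.pi) = F (s, θ)) (s : ℝ) :
    angInt (dirD (0, 1) F) s = 0 := by
  have hD : ContDiff ℝ (⊤ : ℕ∞) (dirD (0, 1) F) := contDiff_dirD hF
  unfold angInt
  rw [intervalIntegral.integral_eq_sub_of_hasDerivAt (f := fun θ => F (s, θ))
    (fun θ _ => hasDerivAt_snd hF s θ)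
    ((continuous_slice hD.continuous s).intervalIntegrable _ _)]
  have := hper s 0
  simp only [zero_add] at this
  rw [this, sub_self]

lemma dirD_periodic {F : ℝ × ℝ → V} (hper : ∀ s θ, F (s, θ + 2 * Real.pi) = F (s, θ))
    (v : ℝ × ℝ) (s θ : ℝ) : dirD v F (s, θ + 2 * Real.pi) = dirD v F (s, θ) := by
  have h : (fun p : ℝ × ℝ => F (p + (0, 2 * Real.pi))) = F := by
    funext ⟨a, b⟩
    simpa using hper a b
  have h2 := fderiv_comp_add_right (𝕜 := ℝ) (f := F) (x := (s, θ)) ((0 : ℝ), 2 * Real.pi)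
  rw [h] at h2
  simp only [dirD, h2, Prod.mk_add_mk, add_zero]

lemma angInt_add {F G : ℝ × ℝ → V} (hF : Continuous F) (hG : Continuous G) (s : ℝ) :
    angInt (fun p => F p + G p) s = angInt F s + angInt G s :=
  intervalIntegral.integral_add ((continuous_slice hF s).intervalIntegrable _ _)
    ((continuous_slice hG s).intervalIntegrable _ _)

lemma angInt_sub {F G : ℝ × ℝ → V} (hF : Continuous F) (hG : Continuous G) (s : ℝ) :
    angInt (fun p => F p - G p) s = angInt F s - angInt G s :=
  intervalIntegral.integral_sub ((continuous_slice hF s).intervalIntegrable _ _)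
    ((continuous_slice hG s).intervalIntegrable _ _)

lemma angInt_const_mul (c : ℝ) (F : ℝ × ℝ → ℝ) (s : ℝ) :
    angInt (fun p => c * F p) s = c * angInt F s :=
  intervalIntegral.integral_const_mul _ _

lemma angInt_congr {F G : ℝ × ℝ → V} {s : ℝ} (h : ∀ θ, F (s, θ) = G (s, θ)) :
    angInt F s = angInt G s := by
  simp only [angInt, h]

lemma angInt_mono {F G : ℝ × ℝ → ℝ} (hF : Continuous F) (hG : Continuous G) {s : ℝ}
    (h : ∀ θ ∈ Set.Icc 0 (2 * Real.pi), F (s, θ) ≤ G (s, θ)) : angInt F s ≤ angInt G s :=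
  intervalIntegral.integral_mono_on (by positivity)
    ((continuous_slice hF s).intervalIntegrable _ _)
    ((continuous_slice hG s).intervalIntegrable _ _) h

lemma norm_angInt_le {F : ℝ × ℝ → V} {s C : ℝ}
    (h : ∀ θ ∈ Set.Icc 0 (2 * Real.pi), ‖F (s, θ)‖ ≤ C) :
    ‖angInt F s‖ ≤ 2 * Real.pi * C := by
  have := intervalIntegral.norm_integral_le_of_norm_le_const (a := 0) (b := 2 * Real.pi)
    (f := fun θ => F (s, θ)) (C := C) (fun θ hθ => by
      rw [Set.uIoc_of_le (by positivity)] at hθ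
      exact h θ ⟨hθ.1.le, hθ.2⟩)
  rw [sub_zero, abs_of_nonneg (by positivity)] at this
  unfold angInt
  linarith

lemma norm_angInt_le_sqrt {F : ℝ × ℝ → V} (hF : Continuous F) (s : ℝ) :
    ‖angInt F s‖ ^ 2 ≤ 2 * Real.pi * angInt (fun p => ‖F p‖ ^ 2) s := by
  set N := ‖angInt F s‖ with hN
  have hpi := Real.pi_pos
  have h1 : N ≤ angInt (fun p => ‖F p‖) s :=
    intervalIntegral.norm_integral_le_integral_norm (by positivity)
  have h2 : angInt (fun p => 2 * (N / (2 * Real.pi)) * ‖F p‖) s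
      ≤ angInt (fun p => ‖F p‖ ^ 2 + (N / (2 * Real.pi)) ^ 2) s :=
    angInt_mono (by fun_prop) (by fun_prop)
      fun θ _ => by nlinarith [sq_nonneg (‖F (s, θ)‖ - N / (2 * Real.pi))]
  rw [angInt_const_mul, angInt_add (by fun_prop) (by fun_prop)] at h2
  have h3 : angInt (fun _ : ℝ × ℝ => (N / (2 * Real.pi)) ^ 2) s
      = N * (N / (2 * Real.pi)) := by
    simp only [angInt, intervalIntegral.integral_const, smul_eq_mul]
    field_simp
    ring
  rw [h3] at h2
  have h4 : 0 ≤ N / (2 * Real.pi) := by positivity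
  have h5 : N / (2 * Real.pi) * N ≤ angInt (fun p => ‖F p‖ ^ 2) s := by nlinarith
  calc N ^ 2 = 2 * Real.pi * (N / (2 * Real.pi) * N) := by field_simp
    _ ≤ _ := by gcongr

lemma angInt_const [CompleteSpace V] (c : V) (s : ℝ) : angInt (fun _ => c) s = (2 * Real.pi) • c := by
  simp [angInt]

lemma norm_sub_slice_le [CompleteSpace V] {F : ℝ × ℝ → V} (hF : ContDiff ℝ (⊤ : ℕ∞) F)
    {s θ φ : ℝ} (hθ : θ ∈ Set.Icc 0 (2 * Real.pi)) (hφ : φ ∈ Set.Icc 0 (2 * Real.pi)) :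
    ‖F (s, θ) - F (s, φ)‖ ≤ angInt (fun p => ‖dirD (0, 1) F p‖) s := by
  wlog h : φ ≤ θ generalizing θ φ
  · rw [norm_sub_rev]
    exact this hφ hθ (not_le.mp h).le
  have hD : Continuous (dirD (0, 1) F) := (contDiff_dirD hF).continuous
  have hc : Continuous fun x => dirD (0, 1) F (s, x) := continuous_slice hD s
  rw [← intervalIntegral.integral_eq_sub_of_hasDerivAt (f := fun θ => F (s, θ))
    (fun θ _ => hasDerivAt_snd hF s θ) (hc.intervalIntegrable _ _)]
  refine (intervalIntegral.norm_integral_le_integral_norm h).trans ?_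
  refine intervalIntegral.integral_mono_interval hφ.1 h hθ.2
    (Eventually.of_forall fun x => norm_nonneg _) (hc.norm.intervalIntegrable _ _)

/-- A Poincaré inequality on the circle for maps with vanishing mean. -/
lemma angInt_sq_le_of_mean_zero [CompleteSpace V] {F : ℝ × ℝ → V}
    (hF : ContDiff ℝ (⊤ : ℕ∞) F) {s : ℝ} (hmean : angInt F s = 0) :
    angInt (fun p => ‖F p‖ ^ 2) s
      ≤ 4 * Real.pi ^ 2 * angInt (fun p => ‖dirD (0, 1) F p‖ ^ 2) s := by
  have hpi := Real.pi_pos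
  have hD : Continuous (dirD (0, 1) F) := (contDiff_dirD hF).continuous
  set A := angInt (fun p => ‖dirD (0, 1) F p‖) s with hA
  have hA2 : A ^ 2 ≤ 2 * Real.pi * angInt (fun p => ‖dirD (0, 1) F p‖ ^ 2) s := by
    have := norm_angInt_le_sqrt (F := fun p => ‖dirD (0, 1) F p‖) (by fun_prop) s
    simpa using this
  have hpt : ∀ θ ∈ Set.Icc 0 (2 * Real.pi), ‖F (s, θ)‖ ≤ A := by
    intro θ hθ
    have h1 : ‖angInt (fun p => F (s, θ) - F p) s‖ ≤ 2 * Real.pi * A :=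
      norm_angInt_le fun φ hφ => norm_sub_slice_le hF hθ hφ
    rw [angInt_sub (F := fun _ => F (s, θ)) continuous_const hF.continuous, angInt_const, hmean,
      sub_zero, norm_smul, Real.norm_eq_abs, abs_of_pos (by positivity)] at h1
    exact le_of_mul_le_mul_left h1 (by positivity)
  calc angInt (fun p => ‖F p‖ ^ 2) s ≤ angInt (fun _ => A ^ 2) s :=
        angInt_mono (hF.continuous.norm.pow 2) continuous_const fun θ hθ =>
          pow_le_pow_left₀ (norm_nonneg _) (hpt θ hθ) 2
    _ = 2 * Real.pi * A ^ 2 := by rw [angInt_const, smul_eq_mul]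
    _ ≤ 2 * Real.pi * (2 * Real.pi * angInt (fun p => ‖dirD (0, 1) F p‖ ^ 2) s) := by gcongr
    _ = _ := by ring

end CircleMean

section Polar

/-- Logarithmic polar coordinates `(s, θ) ↦ e^s (cos θ, sin θ)` on the punctured plane. -/
def polar (p : ℝ × ℝ) : E2 :=
  (Real.exp p.1 * Real.cos p.2) • EuclideanSpace.single 0 1
    + (Real.exp p.1 * Real.sin p.2) • EuclideanSpace.single 1 1

@[simp] lemma polar_apply_zero (p : ℝ × ℝ) : polar p 0 = Real.exp p.1 * Real.cos p.2 := by
  simp [polar]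

@[simp] lemma polar_apply_one (p : ℝ × ℝ) : polar p 1 = Real.exp p.1 * Real.sin p.2 := by
  simp [polar]

@[fun_prop]
lemma contDiff_polar : ContDiff ℝ (⊤ : ℕ∞) polar := by
  unfold polar
  fun_prop

lemma norm_sq_eq_coords (x : E2) : ‖x‖ ^ 2 = x 0 ^ 2 + x 1 ^ 2 := by
  simp [EuclideanSpace.norm_sq_eq]

lemma norm_polar (p : ℝ × ℝ) : ‖polar p‖ = Real.exp p.1 := by
  have h : ‖polar p‖ ^ 2 = Real.exp p.1 ^ 2 := by
    rw [norm_sq_eq_coords, polar_apply_zero, polar_apply_one]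
    have := Real.sin_sq_add_cos_sq p.2
    linear_combination Real.exp p.1 ^ 2 * this
  exact (pow_left_inj₀ (norm_nonneg _) (Real.exp_pos _).le two_ne_zero).1 h

lemma polar_periodic (s θ : ℝ) : polar (s, θ + 2 * Real.pi) = polar (s, θ) := by
  simp [polar]

lemma polar_add (a s θ : ℝ) : polar (a + s, θ) = Real.exp a • polar (s, θ) := by
  simp [polar, Real.exp_add, smul_smul, mul_assoc]

lemma exists_polar {x : E2} (hx : x ≠ 0) :
    ∃ θ ∈ Set.Icc 0 (2 * Real.pi), polar (Real.log ‖x‖, θ) = x := by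
  have hn : 0 < ‖x‖ := norm_pos_iff.2 hx
  set z : ℂ := ⟨x 0, x 1⟩ with hz
  have hzn : ‖z‖ = ‖x‖ := by
    have h : ‖z‖ ^ 2 = ‖x‖ ^ 2 := by
      rw [norm_sq_eq_coords, ← Complex.normSq_eq_norm_sq, Complex.normSq_apply]
      ring
    exact (pow_left_inj₀ (norm_nonneg _) hn.le two_ne_zero).1 h
  have h0 : ‖x‖ * Real.cos z.arg = x 0 := by rw [← hzn, Complex.norm_mul_cos_arg]
  have h1 : ‖x‖ * Real.sin z.arg = x 1 := by rw [← hzn, Complex.norm_mul_sin_arg]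
  have hmain : polar (Real.log ‖x‖, z.arg) = x := by
    ext i
    fin_cases i
    · simpa [Real.exp_log hn] using h0
    · simpa [Real.exp_log hn] using h1
  have hpi := Real.pi_pos
  rcases le_or_gt 0 z.arg with h | h
  · exact ⟨z.arg, ⟨h, by linarith [Complex.arg_le_pi z]⟩, hmain⟩
  · exact ⟨z.arg + 2 * Real.pi, ⟨by linarith [Complex.neg_pi_lt_arg z], by linarith⟩,
      by rw [polar_periodic, hmain]⟩

lemma hasDerivAt_polar_fst (s θ : ℝ) :
    HasDerivAt (fun x => polar (x, θ)) (polar (s, θ)) s := by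
  have h := Real.hasDerivAt_exp s
  exact ((h.mul_const (Real.cos θ)).smul_const _).add ((h.mul_const (Real.sin θ)).smul_const _)

lemma hasDerivAt_polar_snd (s θ : ℝ) :
    HasDerivAt (fun x => polar (s, x))
      (polar (s, θ) 0 • EuclideanSpace.single 1 1 - polar (s, θ) 1 • EuclideanSpace.single 0 1)
      θ := by
  have h := (((Real.hasDerivAt_cos θ).const_mul (Real.exp s)).smul_const
    (EuclideanSpace.single 0 1 : E2)).add
    (((Real.hasDerivAt_sin θ).const_mul (Real.exp s)).smul_const
    (EuclideanSpace.single 1 1 : E2))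
  have he : polar (s, θ) 0 • EuclideanSpace.single 1 1
      - polar (s, θ) 1 • (EuclideanSpace.single 0 1 : E2)
      = (Real.exp s * -Real.sin θ) • EuclideanSpace.single 0 1
        + (Real.exp s * Real.cos θ) • EuclideanSpace.single 1 1 := by
    simp only [polar_apply_zero, polar_apply_one, mul_neg, neg_smul]
    abel
  rw [he]
  exact h

variable {l : ℕ}

/-- The Euler operator `x₁∂₁f + x₂∂₂f`. -/
def euler (f : E2 → Eu l) (x : E2) : Eu l := x 0 • pd 0 f x + x 1 • pd 1 f x

/-- The rotation field `x₁∂₂f - x₂∂₁f`. -/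
def rot (f : E2 → Eu l) (x : E2) : Eu l := x 0 • pd 1 f x + (-(x 1)) • pd 0 f x

@[fun_prop]
lemma contDiff_pd {f : E2 → Eu l} (hf : ContDiff ℝ (⊤ : ℕ∞) f) (α : Fin 2) :
    ContDiff ℝ (⊤ : ℕ∞) (pd α f) := contDiff_dirD hf

@[fun_prop]
lemma contDiff_coord (i : Fin 2) : ContDiff ℝ (⊤ : ℕ∞) fun x : E2 => x i := by
  fun_prop

@[fun_prop]
lemma contDiff_lap {f : E2 → Eu l} (hf : ContDiff ℝ (⊤ : ℕ∞) f) :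
    ContDiff ℝ (⊤ : ℕ∞) (lap f) := by
  unfold lap
  fun_prop

@[fun_prop]
lemma contDiff_euler {f : E2 → Eu l} (hf : ContDiff ℝ (⊤ : ℕ∞) f) :
    ContDiff ℝ (⊤ : ℕ∞) (euler f) := by
  unfold euler
  fun_prop

@[fun_prop]
lemma contDiff_rot {f : E2 → Eu l} (hf : ContDiff ℝ (⊤ : ℕ∞) f) :
    ContDiff ℝ (⊤ : ℕ∞) (rot f) := by
  unfold rot
  fun_prop

lemma dirD_coord (v : E2) (i : Fin 2) (x : E2) : dirD v (fun y : E2 => y i) x = v i := by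
  have h : HasFDerivAt (fun y : E2 => y i) (EuclideanSpace.proj i : E2 →L[ℝ] ℝ) x :=
    (EuclideanSpace.proj i : E2 →L[ℝ] ℝ).hasFDerivAt
  simp [dirD, h.fderiv]

lemma euler_eq_fderiv (f : E2 → Eu l) (x : E2) : euler f x = fderiv ℝ f x x := by
  have h : (x 0 • EuclideanSpace.single 0 1 + x 1 • EuclideanSpace.single 1 1 : E2) = x := by
    ext i; fin_cases i <;> simp
  have h2 := congrArg (fderiv ℝ f x) h
  rw [map_add, map_smul, map_smul] at h2
  exact h2

lemma euler_euler_add_rot_rot {f : E2 → Eu l} (hf : ContDiff ℝ (⊤ : ℕ∞) f) (x : E2) :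
    euler (euler f) x + rot (rot f) x = ‖x‖ ^ 2 • lap f x := by
  have hE : ∀ i : Fin 2, pd i (euler f) x = x 0 • pd i (pd 0 f) x
      + (EuclideanSpace.single i 1 : E2) 0 • pd 0 f x
      + (x 1 • pd i (pd 1 f) x + (EuclideanSpace.single i 1 : E2) 1 • pd 1 f x) := by
    intro i
    change dirD _ (fun y : E2 => y 0 • pd 0 f y + y 1 • pd 1 f y) x = _
    rw [dirD_add (by fun_prop) (by fun_prop), dirD_smul (by fun_prop) (by fun_prop),
      dirD_smul (by fun_prop) (by fun_prop), dirD_coord, dirD_coord]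
    rfl
  have hR : ∀ i : Fin 2, pd i (rot f) x = x 0 • pd i (pd 1 f) x
      + (EuclideanSpace.single i 1 : E2) 0 • pd 1 f x
      + (-(x 1) • pd i (pd 0 f) x - (EuclideanSpace.single i 1 : E2) 1 • pd 0 f x) := by
    intro i
    have h1 : dirD (EuclideanSpace.single i 1) (fun y : E2 => -(y 1)) x
        = -((EuclideanSpace.single i 1 : E2) 1) := by
      rw [← dirD_coord (EuclideanSpace.single i 1) 1 x]
      simp only [dirD]
      rw [fderiv_fun_neg]
      rfl
    change dirD _ (fun y : E2 => y 0 • pd 1 f y + (-(y 1)) • pd 0 f y) x = _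
    rw [dirD_add (by fun_prop) (by fun_prop), dirD_smul (by fun_prop) (by fun_prop),
      dirD_smul (by fun_prop) (by fun_prop), dirD_coord, h1, sub_eq_add_neg, neg_smul ((EuclideanSpace.single i 1 : E2) 1)]
    rfl
  simp only [euler.eq_def (euler f), rot.eq_def (rot f), hE, hR, lap, norm_sq_eq_coords]
  simp
  module

lemma dirD_comp_polar_fst {f : E2 → Eu l} (hf : ContDiff ℝ (⊤ : ℕ∞) f) :
    dirD (1, 0) (fun p => f (polar p)) = fun p => euler f (polar p) := by
  funext ⟨s, θ⟩
  have hF : ContDiff ℝ (⊤ : ℕ∞) (fun p => f (polar p)) := hf.comp contDiff_polar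
  have h := (hf.diffAt (polar (s, θ))).hasFDerivAt.comp_hasDerivAt s (hasDerivAt_polar_fst s θ)
  rw [euler_eq_fderiv]
  exact (hasDerivAt_fst hF s θ).unique h

lemma dirD_comp_polar_snd {f : E2 → Eu l} (hf : ContDiff ℝ (⊤ : ℕ∞) f) :
    dirD (0, 1) (fun p => f (polar p)) = fun p => rot f (polar p) := by
  funext ⟨s, θ⟩
  have hF : ContDiff ℝ (⊤ : ℕ∞) (fun p => f (polar p)) := hf.comp contDiff_polar
  have h := (hf.diffAt (polar (s, θ))).hasFDerivAt.comp_hasDerivAt θ (hasDerivAt_polar_snd s θ)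
  rw [(hasDerivAt_snd hF s θ).unique h, map_sub, map_smul, map_smul, sub_eq_add_neg]
  simp only [rot, neg_smul]
  rfl

lemma cyl_laplacian {f : E2 → Eu l} (hf : ContDiff ℝ (⊤ : ℕ∞) f) (p : ℝ × ℝ) :
    dirD (1, 0) (dirD (1, 0) fun p => f (polar p)) p
      + dirD (0, 1) (dirD (0, 1) fun p => f (polar p)) p
      = Real.exp (2 * p.1) • lap f (polar p) := by
  rw [dirD_comp_polar_fst hf, dirD_comp_polar_snd hf, dirD_comp_polar_fst (contDiff_euler hf),
    dirD_comp_polar_snd (contDiff_rot hf), euler_euler_add_rot_rot hf, norm_polar, ← Real.exp_nat_mul]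
  simp

lemma angInt_comp_polar_tendsto {Φ : E2 → ℝ} (hΦ : Continuous Φ) (h0 : Φ 0 = 0) :
    Tendsto (angInt fun p => Φ (polar p)) atBot (nhds 0) := by
  rw [Metric.tendsto_nhds]
  intro η hη
  have hpi := Real.pi_pos
  obtain ⟨ρ, hρ, hball⟩ := Metric.continuousAt_iff.1 (hΦ.continuousAt (x := 0))
    (η / (4 * Real.pi)) (by positivity)
  filter_upwards [eventually_lt_atBot (Real.log ρ)] with s hs
  have hb : ‖angInt (fun p => Φ (polar p)) s‖ ≤ 2 * Real.pi * (η / (4 * Real.pi)) := by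
    refine norm_angInt_le fun θ _ => ?_
    have := hball (x := polar (s, θ)) (by
      rw [dist_zero_right, norm_polar]
      exact (Real.lt_log_iff_exp_lt hρ).1 hs)
    rw [h0, dist_zero_right] at this
    exact this.le
  rw [dist_zero_right]
  refine hb.trans_lt ?_
  have : 2 * Real.pi * (η / (4 * Real.pi)) = η / 2 := by field_simp; ring
  rw [this]
  linarith

end Polar

section PolarBounds

lemma exists_polar_deriv_bound : ∃ D : ℝ, 1 ≤ D ∧ ∀ θ ∈ Set.Icc 0 (2 * Real.pi),
    ∀ i : ℕ, 1 ≤ i → i ≤ 3 → ‖iteratedFDeriv ℝ i polar (0, θ)‖ ≤ D ^ i := by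
  have h : ∀ i : ℕ, ∃ C : ℝ, ∀ θ ∈ Set.Icc 0 (2 * Real.pi),
      ‖iteratedFDeriv ℝ i polar (0, θ)‖ ≤ C := by
    intro i
    have hc : Continuous fun θ : ℝ => iteratedFDeriv ℝ i polar (0, θ) :=
      (contDiff_polar.continuous_iteratedFDeriv (m := i) (by exact_mod_cast le_top)).comp
        (by fun_prop)
    exact isCompact_Icc.exists_bound_of_continuousOn hc.continuousOn
  choose C hC using h
  have hD : 1 ≤ 1 + |C 1| + |C 2| + |C 3| := by
    linarith [abs_nonneg (C 1), abs_nonneg (C 2), abs_nonneg (C 3)]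
  refine ⟨1 + |C 1| + |C 2| + |C 3|, hD, fun θ hθ i h1 h3 => ?_⟩
  refine (hC i θ hθ).trans (le_trans ?_ (le_self_pow₀ hD (by lia)))
  have := le_abs_self (C i)
  interval_cases i <;> linarith [abs_nonneg (C 1), abs_nonneg (C 2), abs_nonneg (C 3)]

lemma exists_comp_polar_bound : ∃ C : ℝ, 1 ≤ C ∧ ∀ (l : ℕ) (f : E2 → Eu l),
    ContDiff ℝ (⊤ : ℕ∞) f → ∀ κ s θ : ℝ, 0 ≤ κ → θ ∈ Set.Icc 0 (2 * Real.pi) →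
    (∀ t ∈ ({1, 2, 3} : Set ℕ),
      ‖iteratedFDeriv ℝ t f (polar (s, θ))‖ ≤ κ / ‖polar (s, θ)‖ ^ t) →
    ∀ j : ℕ, 1 ≤ j → j ≤ 3 →
      ‖iteratedFDeriv ℝ j (fun p => f (polar p)) (s, θ)‖ ≤ C * κ := by
  obtain ⟨D, hD1, hD⟩ := exists_polar_deriv_bound
  have hD3 : 1 ≤ D ^ 3 := one_le_pow₀ hD1
  refine ⟨6 * D ^ 3, by linarith, fun l f hf κ s θ hκ hθ hb j hj1 hj3 => ?_⟩
  set c : Eu l := f (polar (s, θ)) with hc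
  set h : E2 → Eu l := fun y => f (Real.exp s • y) - c with hh
  have hs : ContDiff ℝ (⊤ : ℕ∞) fun y => f (Real.exp s • y) := by fun_prop
  have hsmooth : ContDiff ℝ (⊤ : ℕ∞) h := by fun_prop
  have hle : ∀ i : ℕ, (i : WithTop ℕ∞) ≤ ((⊤ : ℕ∞) : WithTop ℕ∞) :=
    fun i => by exact_mod_cast le_top
  have hsp : Real.exp s • polar (0, θ) = polar (s, θ) := by
    rw [← polar_add, add_zero]
  have hderiv : ∀ i : ℕ, i ≤ 3 → ‖iteratedFDeriv ℝ i h (polar (0, θ))‖ ≤ κ := by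
    intro i hi
    rcases Nat.eq_zero_or_pos i with rfl | hpos
    · rw [norm_iteratedFDeriv_zero, hh]
      simp only [hsp, hc, sub_self, norm_zero, hκ]
    · have h1 : iteratedFDeriv ℝ i h (polar (0, θ))
          = Real.exp s ^ i • iteratedFDeriv ℝ i f (polar (s, θ)) := by
        rw [hh, fun_iteratedFDeriv_sub_apply (hs.of_le (hle i)).contDiffAt contDiffAt_const,
          iteratedFDeriv_const_of_ne hpos.ne', iteratedFDeriv_comp_const_smul _ (hf.of_le (hle i))]
        simp [hsp]
      have h2 := hb i (by
        simp only [Set.mem_insert_iff, Set.mem_singleton_iff]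
        lia)
      rw [norm_polar, le_div_iff₀ (by positivity)] at h2
      rw [h1, norm_smul, Real.norm_eq_abs, abs_of_pos (by positivity), mul_comm]
      exact h2
  have hcomp := norm_iteratedFDeriv_comp_le (n := j) hsmooth contDiff_polar (hle j) (0, θ)
    (fun i hi => hderiv i (hi.trans hj3)) (fun i h1 hi => hD θ hθ i h1 (hi.trans hj3))
  have heq : (fun p : ℝ × ℝ => f (polar p)) = fun p => (h ∘ polar) (p + (-s, 0)) + c := by
    funext ⟨a, b⟩
    simp only [hh, Function.comp_apply, Prod.mk_add_mk, add_zero, sub_add_cancel, ← polar_add]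
    congr 3
    ring
  have hcs : ContDiff ℝ (⊤ : ℕ∞) fun p : ℝ × ℝ => (h ∘ polar) (p + (-s, 0)) :=
    (hsmooth.comp contDiff_polar).comp (by fun_prop)
  rw [heq, fun_iteratedFDeriv_add_apply (hcs.of_le (hle j)).contDiffAt contDiffAt_const,
    iteratedFDeriv_const_of_ne (by lia), iteratedFDeriv_comp_add_right]
  simp only [Prod.mk_add_mk, add_neg_cancel, add_zero, Pi.zero_apply]
  refine hcomp.trans ?_
  have hfac : (j.factorial : ℝ) ≤ 6 := by
    have : j.factorial ≤ Nat.factorial 3 := Nat.factorial_le hj3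
    exact_mod_cast this
  have hpow : D ^ j ≤ D ^ 3 := pow_le_pow_right₀ hD1 hj3
  calc (j.factorial : ℝ) * κ * D ^ j ≤ 6 * κ * D ^ 3 := by gcongr
    _ = 6 * D ^ 3 * κ := by ring

variable {E V : Type*} [NormedAddCommGroup E] [NormedSpace ℝ E]
  [NormedAddCommGroup V] [InnerProductSpace ℝ V]

lemma norm_dirD_le {F : E → V} (hF : ContDiff ℝ (⊤ : ℕ∞) F) {v p : E} (hv : ‖v‖ ≤ 1) :
    ‖dirD v F p‖ ≤ ‖iteratedFDeriv ℝ 1 F p‖ := by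
  rw [← norm_iteratedFDeriv_zero (𝕜 := ℝ)]
  exact norm_iteratedFDeriv_dirD_le hF hv 0 p

lemma norm_dirD_dirD_le {F : E → V} (hF : ContDiff ℝ (⊤ : ℕ∞) F) {v w p : E} (hv : ‖v‖ ≤ 1)
    (hw : ‖w‖ ≤ 1) : ‖dirD v (dirD w F) p‖ ≤ ‖iteratedFDeriv ℝ 2 F p‖ :=
  (norm_dirD_le (contDiff_dirD hF) hv).trans (norm_iteratedFDeriv_dirD_le hF hw 1 p)

lemma norm_dirD_dirD_dirD_le {F : E → V} (hF : ContDiff ℝ (⊤ : ℕ∞) F) {v w z p : E}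
    (hv : ‖v‖ ≤ 1) (hw : ‖w‖ ≤ 1) (hz : ‖z‖ ≤ 1) :
    ‖dirD v (dirD w (dirD z F)) p‖ ≤ ‖iteratedFDeriv ℝ 3 F p‖ :=
  (norm_dirD_dirD_le (contDiff_dirD hF) hv hw).trans (norm_iteratedFDeriv_dirD_le hF hz 2 p)

lemma norm_lap_le {l : ℕ} {f : E2 → Eu l} (hf : ContDiff ℝ (⊤ : ℕ∞) f) (x : E2) :
    ‖lap f x‖ ≤ 2 * ‖iteratedFDeriv ℝ 2 f x‖ := by
  have h : ∀ i : Fin 2, ‖pd i (pd i f) x‖ ≤ ‖iteratedFDeriv ℝ 2 f x‖ := fun i =>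
    norm_dirD_dirD_le hf (by simp) (by simp)
  unfold lap
  linarith [norm_add_le (pd 0 (pd 0 f) x) (pd 1 (pd 1 f) x), h 0, h 1]

end PolarBounds

/-- The axial derivative on the cylinder. -/
local notation "dS" => dirD ((1 : ℝ), (0 : ℝ))

/-- The angular derivative on the cylinder. -/
local notation "dT" => dirD ((0 : ℝ), (1 : ℝ))

section Cylinder

variable {V : Type*} [NormedAddCommGroup V] [InnerProductSpace ℝ V]

/-- A sphere-valued `ε`-harmonic map written in logarithmic polar coordinates: `W` is the map,
`g` is its planar Laplacian, and the equation holds on the half-cylinder `s < b`. -/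
structure IsCylEpsHarmonic (ε b : ℝ) (W g : ℝ × ℝ → V) : Prop where
  smooth : ContDiff ℝ (⊤ : ℕ∞) W
  smooth_lap : ContDiff ℝ (⊤ : ℕ∞) g
  periodic : ∀ s θ, W (s, θ + 2 * Real.pi) = W (s, θ)
  periodic_lap : ∀ s θ, g (s, θ + 2 * Real.pi) = g (s, θ)
  lap_eq : ∀ p, dS (dS W) p + dT (dT W) p = Real.exp (2 * p.1) • g p
  norm_eq : ∀ p : ℝ × ℝ, p.1 < b → ‖W p‖ = 1
  eq : ∀ p : ℝ × ℝ, p.1 < b →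
    ∃ c : ℝ, Real.exp (2 * p.1) • g p - ε • (dS (dS g) p + dT (dT g) p) = c • W p

/-- The tangential part of `∂_θ∂_θ W` for a sphere-valued map `W`. -/
def tanT (W : ℝ × ℝ → V) (p : ℝ × ℝ) : V := dT (dT W) p + ⟪dT W p, dT W p⟫ • W p

/-- The density of the Pohozaev quantity on the cylinder. -/
def pohozaevDensity (ε : ℝ) (W g : ℝ × ℝ → V) (p : ℝ × ℝ) : ℝ :=
  (1 / 2) * (⟪dS W p, dS W p⟫ + (-1) * ⟪dT W p, dT W p⟫)
    + (-ε) * (⟪dS W p, dS g p⟫ + ((-1) * ⟪dS (dS W) p, g p⟫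
      + (1 / 2) * ⟪Real.exp (2 * p.1) • g p, g p⟫))

@[fun_prop]
lemma contDiff_tanT {W : ℝ × ℝ → V} (hW : ContDiff ℝ (⊤ : ℕ∞) W) :
    ContDiff ℝ (⊤ : ℕ∞) (tanT W) := by
  unfold tanT
  exact (contDiff_dirD (contDiff_dirD hW)).add
    (((contDiff_dirD hW).inner ℝ (contDiff_dirD hW)).smul hW)

lemma dirD_tanT {W : ℝ × ℝ → V} (hW : ContDiff ℝ (⊤ : ℕ∞) W) (v p : ℝ × ℝ) :
    dirD v (tanT W) p = dirD v (dT (dT W)) p + (⟪dT W p, dT W p⟫ • dirD v W p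
      + (2 * ⟪dT W p, dirD v (dT W) p⟫) • W p) := by
  have h1 := contDiff_dirD (v := (0, 1)) hW
  have h2 := h1.inner ℝ h1
  have h4 : ContDiff ℝ (⊤ : ℕ∞) fun q => ⟪dT W q, dT W q⟫ • W q := h2.smul hW
  have h3 := dirD_add (contDiff_dirD (v := (0, 1)) h1) h4 v p
  rw [dirD_smul h2 hW, dirD_inner h1 h1, real_inner_comm (dT W p) (dirD v (dT W) p), ← two_mul] at h3
  exact h3

lemma dirD_const_mul {F : ℝ × ℝ → ℝ} (hF : ContDiff ℝ (⊤ : ℕ∞) F) (c : ℝ) (v p : ℝ × ℝ) :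
    dirD v (fun q => c * F q) p = c * dirD v F p := by
  simp only [dirD]
  rw [fderiv_const_mul (hF.diffAt p)]
  rfl

lemma inner_periodic {A B : ℝ × ℝ → V} (hA : ∀ s θ, A (s, θ + 2 * Real.pi) = A (s, θ))
    (hB : ∀ s θ, B (s, θ + 2 * Real.pi) = B (s, θ)) (s θ : ℝ) :
    ⟪A (s, θ + 2 * Real.pi), B (s, θ + 2 * Real.pi)⟫ = ⟪A (s, θ), B (s, θ)⟫ := by
  rw [hA, hB]

/-- Integration by parts on the circle. -/
lemma angInt_inner_add_eq_zero {A B : ℝ × ℝ → V} (hA : ContDiff ℝ (⊤ : ℕ∞) A)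
    (hB : ContDiff ℝ (⊤ : ℕ∞) B) (pA : ∀ s θ, A (s, θ + 2 * Real.pi) = A (s, θ))
    (pB : ∀ s θ, B (s, θ + 2 * Real.pi) = B (s, θ)) (s : ℝ) :
    angInt (fun p => ⟪A p, dT B p⟫ + ⟪dT A p, B p⟫) s = 0 := by
  refine Eq.trans ?_ (angInt_dirD_snd (hA.inner ℝ hB) (inner_periodic pA pB) s)
  exact angInt_congr fun θ => (dirD_inner hA hB _ _).symm

namespace IsCylEpsHarmonic

variable {ε b : ℝ} {W g : ℝ × ℝ → V}

lemma inner_dirD (h : IsCylEpsHarmonic ε b W g) (v : ℝ × ℝ) {p : ℝ × ℝ} (hp : p.1 < b) :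
    ⟪W p, dirD v W p⟫ = 0 := by
  have hev : (fun q => ⟪W q, W q⟫) =ᶠ[nhds p] fun _ => (1 : ℝ) := by
    filter_upwards [(isOpen_lt continuous_fst continuous_const).mem_nhds hp] with q hq
    rw [real_inner_self_eq_norm_sq, h.norm_eq q hq, one_pow]
  have h1 := dirD_congr hev v
  rw [dirD_inner h.smooth h.smooth, real_inner_comm] at h1
  have h2 : dirD v (fun _ : ℝ × ℝ => (1 : ℝ)) p = 0 := by simp [dirD]
  rw [h2] at h1
  rw [real_inner_comm]
  linarith

lemma inner_dirD_dirD (h : IsCylEpsHarmonic ε b W g) (v : ℝ × ℝ) {p : ℝ × ℝ} (hp : p.1 < b) :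
    ⟪W p, dirD v (dirD v W) p⟫ = -⟪dirD v W p, dirD v W p⟫ := by
  have hev : (fun q => ⟪W q, dirD v W q⟫) =ᶠ[nhds p] fun _ => (0 : ℝ) := by
    filter_upwards [(isOpen_lt continuous_fst continuous_const).mem_nhds hp] with q hq
    exact h.inner_dirD v hq
  have h1 := dirD_congr hev v
  rw [dirD_inner h.smooth (contDiff_dirD h.smooth)] at h1
  have h2 : dirD v (fun _ : ℝ × ℝ => (0 : ℝ)) p = 0 := by simp [dirD]
  rw [h2] at h1
  linarith

/-- Pairing the equation with a vector tangent to the sphere. -/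
lemma inner_tangent (h : IsCylEpsHarmonic ε b W g) {p : ℝ × ℝ} (hp : p.1 < b) {τ : V}
    (hτ : ⟪W p, τ⟫ = 0) :
    ⟪τ, dS (dS W) p⟫ + ⟪τ, dT (dT W) p⟫ = ε * (⟪τ, dS (dS g) p⟫ + ⟪τ, dT (dT g) p⟫) := by
  obtain ⟨c, hc⟩ := h.eq p hp
  have h1 := congrArg (fun z => ⟪τ, z⟫) hc
  simp only [← h.lap_eq p, inner_sub_right, inner_add_right, inner_smul_right] at h1
  rw [real_inner_comm] at hτ
  rw [hτ] at h1
  linarith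

/-- The evolution of the angular energy of an `ε`-harmonic map along the cylinder. -/
lemma hasDerivAt_angular [CompleteSpace V] (h : IsCylEpsHarmonic ε b W g) {s : ℝ} (hs : s < b) :
    HasDerivAt
      (angInt fun p => 2 * ⟪dT W p, dS (dT W) p⟫ + (2 * ε) * ⟪tanT W p, dS g p⟫)
      (angInt (fun p => 2 * ⟪dS (dT W) p, dS (dT W) p⟫ + 2 * ⟪dT (dT W) p, dT (dT W) p⟫
        - 2 * ⟪dT W p, dT W p⟫ * (⟪dS W p, dS W p⟫ + ⟪dT W p, dT W p⟫)
        + 2 * ε * (⟪dS (tanT W) p, dS g p⟫ + ⟪dT (tanT W) p, dT g p⟫)) s) s := by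
  have hW := h.smooth
  have hg := h.smooth_lap
  have hWS : ContDiff ℝ (⊤ : ℕ∞) (dS W) := contDiff_dirD hW
  have hWT : ContDiff ℝ (⊤ : ℕ∞) (dT W) := contDiff_dirD hW
  have hWST : ContDiff ℝ (⊤ : ℕ∞) (dS (dT W)) := contDiff_dirD hWT
  have hWTT : ContDiff ℝ (⊤ : ℕ∞) (dT (dT W)) := contDiff_dirD hWT
  have hWSS : ContDiff ℝ (⊤ : ℕ∞) (dS (dS W)) := contDiff_dirD hWS
  have hgS : ContDiff ℝ (⊤ : ℕ∞) (dS g) := contDiff_dirD hg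
  have hgT : ContDiff ℝ (⊤ : ℕ∞) (dT g) := contDiff_dirD hg
  have hτ : ContDiff ℝ (⊤ : ℕ∞) (tanT W) := contDiff_tanT hW
  have hτS : ContDiff ℝ (⊤ : ℕ∞) (dS (tanT W)) := contDiff_dirD hτ
  have hτT : ContDiff ℝ (⊤ : ℕ∞) (dT (tanT W)) := contDiff_dirD hτ
  have pτ : ∀ s θ, tanT W (s, θ + 2 * Real.pi) = tanT W (s, θ) := fun s θ => by
    simp only [tanT, dirD_periodic h.periodic, dirD_periodic (dirD_periodic h.periodic (0, 1)),
      h.periodic]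
  have hA : ContDiff ℝ (⊤ : ℕ∞) fun p => 2 * ⟪dT W p, dS (dT W) p⟫ :=
    contDiff_const.mul (hWT.inner ℝ hWST)
  have hB : ContDiff ℝ (⊤ : ℕ∞) fun p => (2 * ε) * ⟪tanT W p, dS g p⟫ :=
    contDiff_const.mul (hτ.inner ℝ hgS)
  have hmain := hasDerivAt_angInt (hA.add hB) s
  have hz1 := angInt_inner_add_eq_zero hWT hWSS (dirD_periodic h.periodic _)
    (dirD_periodic (dirD_periodic h.periodic _) _) s
  have hz2 := angInt_inner_add_eq_zero hτ hgT pτ (dirD_periodic h.periodic_lap _) s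
  refine hmain.congr_deriv ?_
  have hWc := hW.continuous
  have hWSc := hWS.continuous
  have hWTc := hWT.continuous
  have hWSTc := hWST.continuous
  have hWTTc := hWTT.continuous
  have hWSSc := hWSS.continuous
  have hgSc := hgS.continuous
  have hgTc := hgT.continuous
  have hτc := hτ.continuous
  have hτSc := hτS.continuous
  have hτTc := hτT.continuous
  have hWTSSc : Continuous (dT (dS (dS W))) := (contDiff_dirD hWSS).continuous
  have hgTTc : Continuous (dT (dT g)) := (contDiff_dirD hgT).continuous
  have hsum : angInt (dirD (1, 0) fun p =>
        2 * ⟪dT W p, dS (dT W) p⟫ + (2 * ε) * ⟪tanT W p, dS g p⟫) s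
      = angInt (fun p => (2 * ⟪dS (dT W) p, dS (dT W) p⟫ + 2 * ⟪dT (dT W) p, dT (dT W) p⟫
        - 2 * ⟪dT W p, dT W p⟫ * (⟪dS W p, dS W p⟫ + ⟪dT W p, dT W p⟫)
        + 2 * ε * (⟪dS (tanT W) p, dS g p⟫ + ⟪dT (tanT W) p, dT g p⟫))
        + (2 * (⟪dT W p, dT (dS (dS W)) p⟫ + ⟪dT (dT W) p, dS (dS W) p⟫)
        + (-2 * ε) * (⟪tanT W p, dT (dT g) p⟫ + ⟪dT (tanT W) p, dT g p⟫))) s := by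
    refine angInt_congr fun θ => ?_
    rw [dirD_add hA hB, dirD_const_mul (hWT.inner ℝ hWST), dirD_const_mul (hτ.inner ℝ hgS),
      dirD_inner hWT hWST, dirD_inner hτ hgS]
    have hcomm : dS (dS (dT W)) = dT (dS (dS W)) := by
      rw [dirD_comm hW (1, 0) (0, 1), dirD_comm hWS (1, 0) (0, 1)]
    have hW1 := h.norm_eq (s, θ) hs
    have hWTT0 := h.inner_dirD_dirD (0, 1) (p := (s, θ)) hs
    have hWSS0 := h.inner_dirD_dirD (1, 0) (p := (s, θ)) hs
    have htan : ⟪W (s, θ), tanT W (s, θ)⟫ = 0 := by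
      rw [tanT, inner_add_right, inner_smul_right, real_inner_self_eq_norm_sq (W (s, θ)), hW1,
        hWTT0]
      ring
    have hpde := h.inner_tangent (p := (s, θ)) hs htan
    have e1 : ⟪tanT W (s, θ), dS (dS W) (s, θ)⟫ = ⟪dT (dT W) (s, θ), dS (dS W) (s, θ)⟫
        - ⟪dT W (s, θ), dT W (s, θ)⟫ * ⟪dS W (s, θ), dS W (s, θ)⟫ := by
      rw [tanT, inner_add_left, real_inner_smul_left, hWSS0]
      ring
    have e2 : ⟪tanT W (s, θ), dT (dT W) (s, θ)⟫ = ⟪dT (dT W) (s, θ), dT (dT W) (s, θ)⟫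
        - ⟪dT W (s, θ), dT W (s, θ)⟫ * ⟪dT W (s, θ), dT W (s, θ)⟫ := by
      rw [tanT, inner_add_left, real_inner_smul_left, hWTT0]
      ring
    rw [e1, e2] at hpde
    rw [hcomm]
    linear_combination (-2) * hpde
  have hz : angInt (fun p => 2 * (⟪dT W p, dT (dS (dS W)) p⟫ + ⟪dT (dT W) p, dS (dS W) p⟫)
      + (-2 * ε) * (⟪tanT W p, dT (dT g) p⟫ + ⟪dT (tanT W) p, dT g p⟫)) s = 0 := by
    rw [angInt_add (by fun_prop) (by fun_prop), angInt_const_mul, angInt_const_mul, hz1, hz2]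
    ring
  rw [hsum, angInt_add (by fun_prop) (by fun_prop), hz, add_zero]

/-- A Pohozaev-type identity for `ε`-harmonic maps on the cylinder. -/
lemma hasDerivAt_pohozaev [CompleteSpace V] (h : IsCylEpsHarmonic ε b W g) {s : ℝ} (hs : s < b) :
    HasDerivAt
      (angInt (pohozaevDensity ε W g))
      (ε * angInt (fun p => ⟪Real.exp (2 * p.1) • g p, g p⟫) s) s := by
  have hW := h.smooth
  have hg := h.smooth_lap
  have hWS : ContDiff ℝ (⊤ : ℕ∞) (dS W) := contDiff_dirD hW
  have hWT : ContDiff ℝ (⊤ : ℕ∞) (dT W) := contDiff_dirD hW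
  have hWSS : ContDiff ℝ (⊤ : ℕ∞) (dS (dS W)) := contDiff_dirD hWS
  have hWTS : ContDiff ℝ (⊤ : ℕ∞) (dT (dS W)) := contDiff_dirD hWS
  have hgS : ContDiff ℝ (⊤ : ℕ∞) (dS g) := contDiff_dirD hg
  have hgT : ContDiff ℝ (⊤ : ℕ∞) (dT g) := contDiff_dirD hg
  have hexp : ContDiff ℝ (⊤ : ℕ∞) fun p : ℝ × ℝ => Real.exp (2 * p.1) := by fun_prop
  have heg : ContDiff ℝ (⊤ : ℕ∞) fun p : ℝ × ℝ => Real.exp (2 * p.1) • g p := hexp.smul hg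
  have hz1 := angInt_inner_add_eq_zero hWS hWT (dirD_periodic h.periodic _)
    (dirD_periodic h.periodic _) s
  have hz2 := angInt_inner_add_eq_zero hWS hgT (dirD_periodic h.periodic _)
    (dirD_periodic h.periodic_lap _) s
  have hz3 := angInt_inner_add_eq_zero hWTS hg (dirD_periodic (dirD_periodic h.periodic _) _)
    h.periodic_lap s
  have i1 := hWS.inner ℝ hWS
  have i2 := hWT.inner ℝ hWT
  have i3 := hWS.inner ℝ hgS
  have i4 := hWSS.inner ℝ hg
  have i5 := heg.inner ℝ hg
  have j1 : ContDiff ℝ (⊤ : ℕ∞) fun p => (-1 : ℝ) * ⟪dT W p, dT W p⟫ := contDiff_const.mul i2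
  have j2 : ContDiff ℝ (⊤ : ℕ∞) fun p => (-1 : ℝ) * ⟪dS (dS W) p, g p⟫ := contDiff_const.mul i4
  have j3 : ContDiff ℝ (⊤ : ℕ∞) fun p => (1 / 2 : ℝ) * ⟪Real.exp (2 * p.1) • g p, g p⟫ :=
    contDiff_const.mul i5
  have k1 := i1.add j1
  have k2 := j2.add j3
  have k3 := i3.add k2
  have m1 : ContDiff ℝ (⊤ : ℕ∞) fun p =>
      (1 / 2 : ℝ) * (⟪dS W p, dS W p⟫ + (-1) * ⟪dT W p, dT W p⟫) := contDiff_const.mul k1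
  have m2 : ContDiff ℝ (⊤ : ℕ∞) fun p =>
      (-ε) * (⟪dS W p, dS g p⟫ + ((-1) * ⟪dS (dS W) p, g p⟫
          + (1 / 2) * ⟪Real.exp (2 * p.1) • g p, g p⟫)) := contDiff_const.mul k3
  refine (hasDerivAt_angInt (m1.add m2) s).congr_deriv ?_
  have hWSc := hWS.continuous
  have hWTc := hWT.continuous
  have hWSSc := hWSS.continuous
  have hWTSc := hWTS.continuous
  have hgc := hg.continuous
  have hgSc := hgS.continuous
  have hgTc := hgT.continuous
  have hWTTc : Continuous (dT (dT W)) := (contDiff_dirD hWT).continuous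
  have hWTTSc : Continuous (dT (dT (dS W))) := (contDiff_dirD hWTS).continuous
  have hgTTc : Continuous (dT (dT g)) := (contDiff_dirD hgT).continuous
  have hsum : angInt (dirD (1, 0) fun p =>
        (1 / 2 : ℝ) * (⟪dS W p, dS W p⟫ + (-1) * ⟪dT W p, dT W p⟫)
        + (-ε) * (⟪dS W p, dS g p⟫ + ((-1) * ⟪dS (dS W) p, g p⟫
          + (1 / 2) * ⟪Real.exp (2 * p.1) • g p, g p⟫))) s
      = angInt (fun p => ε * ⟪Real.exp (2 * p.1) • g p, g p⟫
        + ((-1) * (⟪dS W p, dT (dT W) p⟫ + ⟪dT (dS W) p, dT W p⟫)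
        + (ε * (⟪dS W p, dT (dT g) p⟫ + ⟪dT (dS W) p, dT g p⟫)
        + (-ε) * (⟪dT (dS W) p, dT g p⟫ + ⟪dT (dT (dS W)) p, g p⟫)))) s := by
    refine angInt_congr fun θ => ?_
    rw [dirD_add m1 m2, dirD_const_mul k1, dirD_const_mul k3, dirD_add i1 j1, dirD_add i3 k2,
      dirD_add j2 j3, dirD_const_mul i2, dirD_const_mul i4, dirD_const_mul i5,
      dirD_inner hWS hWS, dirD_inner hWT hWT, dirD_inner hWS hgS, dirD_inner hWSS hg,
      dirD_inner heg hg, dirD_smul hexp hg]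
    have hcomm : dS (dT W) = dT (dS W) := dirD_comm hW _ _
    have hcomm3 : dS (dT (dT W)) = dT (dT (dS W)) := by
      rw [dirD_comm hWT (1, 0) (0, 1), dirD_comm hW (1, 0) (0, 1)]
    have hpde := h.inner_tangent (p := (s, θ)) hs (h.inner_dirD (1, 0) (p := (s, θ)) hs)
    have hlap : (fun p => dS (dS W) p + dT (dT W) p) = fun p => Real.exp (2 * p.1) • g p :=
      funext h.lap_eq
    have hd : dirD (1, 0) (fun p : ℝ × ℝ => Real.exp (2 * p.1)) (s, θ)
        = 2 * Real.exp (2 * s) := by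
      have h1 := hasDerivAt_fst hexp s θ
      have h2 : HasDerivAt (fun x : ℝ => Real.exp (2 * x)) (Real.exp (2 * s) * (2 * 1)) s :=
        ((hasDerivAt_id s).const_mul 2).exp
      rw [h1.unique h2]
      ring
    have hdl := congrArg (fun F : ℝ × ℝ → V => ⟪dirD (1, 0) F (s, θ), g (s, θ)⟫) hlap
    simp only [dirD_add hWSS (contDiff_dirD hWT), dirD_smul hexp hg, hcomm3, hd,
      inner_add_left, real_inner_smul_left] at hdl
    simp only [hd, hcomm, inner_add_left, real_inner_smul_left]
    have c1 := real_inner_comm (dT W (s, θ)) (dT (dS W) (s, θ))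
    have c2 := real_inner_comm (dS W (s, θ)) (dS (dS W) (s, θ))
    have c4 := real_inner_comm (dS g (s, θ)) (g (s, θ))
    linear_combination hpde + ε * hdl + c2 / 2 + c1 / 2 - ε * Real.exp (2 * s) / 2 * c4
  rw [hsum, angInt_add (by fun_prop) (by fun_prop), angInt_add (by fun_prop) (by fun_prop),
    angInt_add (by fun_prop) (by fun_prop),
    angInt_const_mul, angInt_const_mul, angInt_const_mul, angInt_const_mul, hz1, hz2, hz3]
  ring

end IsCylEpsHarmonic

end Cylinder

section Decay

variable {V : Type*} [NormedAddCommGroup V] [InnerProductSpace ℝ V]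

/-- A decay estimate for nonnegative functions satisfying a perturbed second-order differential
inequality `Θ'' ≥ Θ / 100`, written as a first-order system for `Θ` and `F ≈ Θ'`. -/
lemma decay_of_differential_inequality {Θ Θ' F F' : ℝ → ℝ} {S₀ S₁ K : ℝ} (hK : 0 ≤ K)
    (hΘ : ∀ s ∈ Set.Icc S₀ S₁, HasDerivAt Θ (Θ' s) s)
    (hF : ∀ s ∈ Set.Icc S₀ S₁, HasDerivAt F (F' s) s)
    (hineq : ∀ s ∈ Set.Icc S₀ S₁, Θ s / 100 - 410 * K * Real.exp (-2 * (s - S₀)) ≤ F' s)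
    (hFΘ : ∀ s ∈ Set.Icc S₀ S₁, |F s - Θ' s| ≤ 160 * K * Real.exp (-2 * (s - S₀)))
    (hΘb : ∀ s ∈ Set.Icc S₀ S₁, Θ s ≤ 7 * K)
    (hΘ'b : ∀ s ∈ Set.Icc S₀ S₁, |Θ' s| ≤ 13 * K) :
    ∀ s ∈ Set.Icc S₀ S₁,
      Θ s ≤ 2805 * K * (Real.exp (-(S₁ - s) / 10) + Real.exp (-(s - S₀) / 10)) := by
  have hexp : ∀ c s : ℝ, HasDerivAt (fun x => Real.exp (c * (x - S₀)))
      (Real.exp (c * (s - S₀)) * c) s := fun c s => by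
    simpa using (((hasDerivAt_id s).sub_const S₀).const_mul c).exp
  have hadd : ∀ c d s : ℝ, Real.exp (c * (s - S₀)) * Real.exp (d * (s - S₀))
      = Real.exp ((c + d) * (s - S₀)) := fun c d s => by rw [← Real.exp_add]; ring_nf
  have hle : ∀ c d : ℝ, c ≤ d → ∀ s ∈ Set.Icc S₀ S₁,
      Real.exp (c * (s - S₀)) ≤ Real.exp (d * (s - S₀)) := fun c d hcd s hs =>
    Real.exp_le_exp.mpr (mul_le_mul_of_nonneg_right hcd (by linarith [hs.1]))
  have hP : ∀ s ∈ Set.Icc S₀ S₁,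
      -(401 * K) * Real.exp ((-1 / 10) * (s - S₀)) ≤ F s - Θ s / 10 := by
    intro s hs
    have hmono : MonotoneOn (fun x => Real.exp ((1 / 10) * (x - S₀)) * (F x - Θ x / 10)
        - (4300 / 19) * K * Real.exp ((-19 / 10) * (x - S₀))) (Set.Icc S₀ S₁) := by
      have hd : ∀ x ∈ Set.Icc S₀ S₁, HasDerivAt
          (fun x => Real.exp ((1 / 10) * (x - S₀)) * (F x - Θ x / 10)
            - (4300 / 19) * K * Real.exp ((-19 / 10) * (x - S₀)))
          (Real.exp ((1 / 10) * (x - S₀)) * (1 / 10) * (F x - Θ x / 10)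
            + Real.exp ((1 / 10) * (x - S₀)) * (F' x - Θ' x / 10)
            - (4300 / 19) * K * (Real.exp ((-19 / 10) * (x - S₀)) * (-19 / 10))) x := fun x hx =>
        ((hexp _ x).mul ((hF x hx).sub ((hΘ x hx).div_const 10))).sub ((hexp _ x).const_mul _)
      refine monotoneOn_of_deriv_nonneg (convex_Icc _ _)
        (fun x hx => (hd x hx).continuousAt.continuousWithinAt)
        (fun x hx => (hd x (interior_subset hx)).differentiableAt.differentiableWithinAt)
        (fun x hx => ?_)
      have hx := interior_subset hx
      rw [(hd x hx).deriv]
      have e := hadd (1 / 10) (-2) x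
      norm_num at e
      have h1 := hineq x hx
      have h2 := (abs_le.mp (hFΘ x hx)).1
      have hpos := Real.exp_pos ((1 / 10) * (x - S₀))
      have h3 : -(426 * K) * Real.exp (-2 * (x - S₀))
          ≤ (1 / 10) * (F x - Θ x / 10) + (F' x - Θ' x / 10) := by linarith
      have h4 := mul_le_mul_of_nonneg_left h3 hpos.le
      have h5 := Real.exp_pos ((-19 / 10) * (x - S₀))
      norm_num at h4 h5 ⊢
      have h6 := mul_nonneg hK h5.le
      nlinarith
    have hS₀ : S₀ ∈ Set.Icc S₀ S₁ := ⟨le_rfl, hs.1.trans hs.2⟩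
    have h0 := hmono hS₀ hs hs.1
    simp only [sub_self, mul_zero, Real.exp_zero, mul_one, one_mul] at h0
    have h1 := hΘb S₀ hS₀
    have h2 := (abs_le.mp (hΘ'b S₀ hS₀)).1
    have h3 := (abs_le.mp (hFΘ S₀ hS₀)).1
    simp only [sub_self, mul_zero, Real.exp_zero, mul_one] at h3
    have h4 : -(401 * K) ≤ Real.exp ((1 / 10) * (s - S₀)) * (F s - Θ s / 10) := by
      have := mul_nonneg hK (Real.exp_pos ((-19 / 10) * (s - S₀))).le
      linarith
    have e := hadd (-1 / 10) (1 / 10) s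
    norm_num at e
    have h5 := mul_le_mul_of_nonneg_left h4 (Real.exp_pos ((-1 / 10) * (s - S₀))).le
    rw [← mul_assoc] at h5
    norm_num at h5 ⊢
    rw [e, one_mul] at h5
    linarith
  intro s hs
  have hmono : MonotoneOn (fun x => Real.exp ((-1 / 10) * (x - S₀)) * Θ x
      - 2805 * K * Real.exp ((-1 / 5) * (x - S₀))) (Set.Icc S₀ S₁) := by
    have hd : ∀ x ∈ Set.Icc S₀ S₁, HasDerivAt
        (fun x => Real.exp ((-1 / 10) * (x - S₀)) * Θ x
          - 2805 * K * Real.exp ((-1 / 5) * (x - S₀)))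
        (Real.exp ((-1 / 10) * (x - S₀)) * (-1 / 10) * Θ x
          + Real.exp ((-1 / 10) * (x - S₀)) * Θ' x
          - 2805 * K * (Real.exp ((-1 / 5) * (x - S₀)) * (-1 / 5))) x := fun x hx =>
      ((hexp _ x).mul (hΘ x hx)).sub ((hexp _ x).const_mul _)
    refine monotoneOn_of_deriv_nonneg (convex_Icc _ _)
      (fun x hx => (hd x hx).continuousAt.continuousWithinAt)
      (fun x hx => (hd x (interior_subset hx)).differentiableAt.differentiableWithinAt)
      (fun x hx => ?_)
    have hx := interior_subset hx
    rw [(hd x hx).deriv]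
    have h1 := hP x hx
    have h2 := (abs_le.mp (hFΘ x hx)).2
    have h3 := hle (-2) (-1 / 10) (by norm_num) x hx
    have h4 : -(561 * K) * Real.exp ((-1 / 10) * (x - S₀)) ≤ Θ' x - Θ x / 10 := by
      have := mul_le_mul_of_nonneg_left h3 hK
      linarith
    have e : Real.exp ((-1 / 10) * (x - S₀)) * Real.exp ((-1 / 10) * (x - S₀))
        = Real.exp ((-1 / 5) * (x - S₀)) := by rw [hadd]; norm_num
    rw [← e]
    have h5 := mul_le_mul_of_nonneg_left h4 (Real.exp_pos ((-1 / 10) * (x - S₀))).le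
    linarith
  have hS₁ : S₁ ∈ Set.Icc S₀ S₁ := ⟨hs.1.trans hs.2, le_rfl⟩
  have h0 := hmono hs hS₁ hs.2
  simp only at h0
  have h1 := hΘb S₁ hS₁
  have e1 : Real.exp ((1 / 10) * (s - S₀)) * Real.exp ((-1 / 10) * (s - S₀)) = 1 := by
    rw [hadd]; norm_num
  have e2 : Real.exp ((1 / 10) * (s - S₀)) * Real.exp ((-1 / 5) * (s - S₀))
      = Real.exp (-(s - S₀) / 10) := by rw [hadd]; ring_nf
  have e3 : Real.exp ((1 / 10) * (s - S₀)) * Real.exp ((-1 / 10) * (S₁ - S₀))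
      = Real.exp (-(S₁ - s) / 10) := by rw [← Real.exp_add]; ring_nf
  have h2 : Real.exp ((-1 / 10) * (s - S₀)) * Θ s ≤ 7 * K * Real.exp ((-1 / 10) * (S₁ - S₀))
      + 2805 * K * Real.exp ((-1 / 5) * (s - S₀)) := by
    have h3 := mul_le_mul_of_nonneg_left h1 (Real.exp_pos ((-1 / 10) * (S₁ - S₀))).le
    have := mul_nonneg hK (Real.exp_pos ((-1 / 5) * (S₁ - S₀))).le
    linarith
  have h3 := mul_le_mul_of_nonneg_left h2 (Real.exp_pos ((1 / 10) * (s - S₀))).le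
  rw [← mul_assoc, e1, one_mul] at h3
  have h4 := mul_nonneg hK (Real.exp_pos (-(S₁ - s) / 10)).le
  calc Θ s ≤ _ := h3
    _ = 7 * K * (Real.exp ((1 / 10) * (s - S₀)) * Real.exp ((-1 / 10) * (S₁ - S₀)))
        + 2805 * K * (Real.exp ((1 / 10) * (s - S₀)) * Real.exp ((-1 / 5) * (s - S₀))) := by ring
    _ ≤ _ := by rw [e2, e3]; linarith

lemma abs_inner_le_mul {x y : V} {c d : ℝ} (hx : ‖x‖ ≤ c) (hy : ‖y‖ ≤ d) :
    |⟪x, y⟫| ≤ c * d :=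
  (abs_real_inner_le_norm x y).trans
    (mul_le_mul hx hy (norm_nonneg y) ((norm_nonneg x).trans hx))

namespace IsCylEpsHarmonic

variable {ε b κ : ℝ} {W g : ℝ × ℝ → V} {p : ℝ × ℝ}

lemma norm_lap_le (h : IsCylEpsHarmonic ε b W g)
    (hj : ∀ j : ℕ, 1 ≤ j → j ≤ 3 → ‖iteratedFDeriv ℝ j W p‖ ≤ κ) :
    ‖g p‖ ≤ 2 * κ * Real.exp (-2 * p.1) := by
  have h1 := norm_dirD_dirD_le (p := p) h.smooth (v := (1, 0)) (w := (1, 0)) (by simp) (by simp)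
  have h2 := norm_dirD_dirD_le (p := p) h.smooth (v := (0, 1)) (w := (0, 1)) (by simp) (by simp)
  have h3 := hj 2 (by norm_num) (by norm_num)
  have e : g p = Real.exp (-2 * p.1) • (dS (dS W) p + dT (dT W) p) := by
    rw [h.lap_eq, smul_smul, ← Real.exp_add]
    simp
  rw [e, norm_smul, Real.norm_of_nonneg (Real.exp_pos _).le, mul_comm]
  gcongr
  linarith [norm_add_le (dS (dS W) p) (dT (dT W) p)]

lemma norm_angular_lap_le (h : IsCylEpsHarmonic ε b W g)
    (hj : ∀ j : ℕ, 1 ≤ j → j ≤ 3 → ‖iteratedFDeriv ℝ j W p‖ ≤ κ) :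
    ‖dT g p‖ ≤ 2 * κ * Real.exp (-2 * p.1) := by
  have hS : ContDiff ℝ (⊤ : ℕ∞) (dS (dS W)) := contDiff_dirD (contDiff_dirD h.smooth)
  have hT : ContDiff ℝ (⊤ : ℕ∞) (dT (dT W)) := contDiff_dirD (contDiff_dirD h.smooth)
  have hexp : ContDiff ℝ (⊤ : ℕ∞) fun p : ℝ × ℝ => Real.exp (-2 * p.1) := by fun_prop
  have h1 := norm_dirD_dirD_dirD_le (p := p) h.smooth (v := (0, 1)) (w := (1, 0)) (z := (1, 0))
    (by simp) (by simp) (by simp)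
  have h2 := norm_dirD_dirD_dirD_le (p := p) h.smooth (v := (0, 1)) (w := (0, 1)) (z := (0, 1))
    (by simp) (by simp) (by simp)
  have h3 := hj 3 (by norm_num) (by norm_num)
  have e : g = fun p => Real.exp (-2 * p.1) • (dS (dS W) p + dT (dT W) p) := by
    funext q
    rw [h.lap_eq, smul_smul, ← Real.exp_add]
    simp
  have hd : dT (fun p : ℝ × ℝ => Real.exp (-2 * p.1)) p = 0 :=
    (hasDerivAt_snd hexp p.1 p.2).unique (hasDerivAt_const p.2 (Real.exp (-2 * p.1)))
  rw [e, dirD_smul hexp (hS.add hT), hd, zero_smul, add_zero, dirD_add hS hT, norm_smul,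
    Real.norm_of_nonneg (Real.exp_pos _).le, mul_comm]
  gcongr
  linarith [norm_add_le (dT (dS (dS W)) p) (dT (dT (dT W)) p)]

lemma norm_axial_lap_le (h : IsCylEpsHarmonic ε b W g)
    (hj : ∀ j : ℕ, 1 ≤ j → j ≤ 3 → ‖iteratedFDeriv ℝ j W p‖ ≤ κ) :
    ‖dS g p‖ ≤ 6 * κ * Real.exp (-2 * p.1) := by
  have hS : ContDiff ℝ (⊤ : ℕ∞) (dS (dS W)) := contDiff_dirD (contDiff_dirD h.smooth)
  have hT : ContDiff ℝ (⊤ : ℕ∞) (dT (dT W)) := contDiff_dirD (contDiff_dirD h.smooth)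
  have hexp : ContDiff ℝ (⊤ : ℕ∞) fun p : ℝ × ℝ => Real.exp (-2 * p.1) := by fun_prop
  have h1 := norm_dirD_dirD_dirD_le (p := p) h.smooth (v := (1, 0)) (w := (1, 0)) (z := (1, 0))
    (by simp) (by simp) (by simp)
  have h2 := norm_dirD_dirD_dirD_le (p := p) h.smooth (v := (1, 0)) (w := (0, 1)) (z := (0, 1))
    (by simp) (by simp) (by simp)
  have h3 := hj 3 (by norm_num) (by norm_num)
  have h4 := norm_dirD_dirD_le (p := p) h.smooth (v := (1, 0)) (w := (1, 0)) (by simp) (by simp)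
  have h5 := norm_dirD_dirD_le (p := p) h.smooth (v := (0, 1)) (w := (0, 1)) (by simp) (by simp)
  have h6 := hj 2 (by norm_num) (by norm_num)
  have e : g = fun p => Real.exp (-2 * p.1) • (dS (dS W) p + dT (dT W) p) := by
    funext q
    rw [h.lap_eq, smul_smul, ← Real.exp_add]
    simp
  have hd : dS (fun p : ℝ × ℝ => Real.exp (-2 * p.1)) p = -2 * Real.exp (-2 * p.1) := by
    have h7 : HasDerivAt (fun x : ℝ => Real.exp (-2 * x)) (Real.exp (-2 * p.1) * (-2 * 1)) p.1 :=
      ((hasDerivAt_id p.1).const_mul (-2)).exp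
    rw [(hasDerivAt_fst hexp p.1 p.2).unique h7]
    ring
  have hd' : dS (fun p : ℝ × ℝ => Real.exp (-2 * p.1)) p • (dS (dS W) p + dT (dT W) p)
      = Real.exp (-2 * p.1) • ((-2 : ℝ) • (dS (dS W) p + dT (dT W) p)) := by
    rw [hd, smul_smul, mul_comm]
  rw [e, dirD_smul hexp (hS.add hT), hd', dirD_add hS hT, ← smul_add,
    norm_smul, Real.norm_of_nonneg (Real.exp_pos _).le, mul_comm]
  gcongr
  refine (norm_add_le _ _).trans ?_
  rw [norm_smul, Real.norm_eq_abs, abs_neg, abs_two]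
  linarith [norm_add_le (dS (dS (dS W)) p) (dS (dT (dT W)) p),
    norm_add_le (dS (dS W) p) (dT (dT W) p)]

lemma norm_tanT_le (h : IsCylEpsHarmonic ε b W g) (hp : p.1 < b) (hκ : κ ≤ 1)
    (hj : ∀ j : ℕ, 1 ≤ j → j ≤ 3 → ‖iteratedFDeriv ℝ j W p‖ ≤ κ) : ‖tanT W p‖ ≤ 2 * κ := by
  have h1 := norm_dirD_le (p := p) h.smooth (v := (0, 1)) (by simp)
  have h2 := norm_dirD_dirD_le (p := p) h.smooth (v := (0, 1)) (w := (0, 1)) (by simp) (by simp)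
  have h3 := hj 1 (by norm_num) (by norm_num)
  have h4 := hj 2 (by norm_num) (by norm_num)
  have h5 := norm_nonneg (dT W p)
  unfold tanT
  refine (norm_add_le _ _).trans ?_
  rw [norm_smul, h.norm_eq p hp, real_inner_self_eq_norm_sq, norm_pow, norm_norm]
  nlinarith

lemma norm_dirD_tanT_le (h : IsCylEpsHarmonic ε b W g) (hp : p.1 < b) (hκ : κ ≤ 1)
    (hj : ∀ j : ℕ, 1 ≤ j → j ≤ 3 → ‖iteratedFDeriv ℝ j W p‖ ≤ κ) {v : ℝ × ℝ} (hv : ‖v‖ ≤ 1) :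
    ‖dirD v (tanT W) p‖ ≤ 4 * κ := by
  have h1 := norm_dirD_le (p := p) h.smooth (v := (0, 1)) (by simp)
  have h1' := norm_dirD_le (p := p) h.smooth hv
  have h2 := norm_dirD_dirD_le (p := p) h.smooth hv (w := (0, 1)) (by simp)
  have h2' := norm_dirD_dirD_dirD_le (p := p) h.smooth hv (w := (0, 1)) (z := (0, 1))
    (by simp) (by simp)
  have h3 := hj 1 (by norm_num) (by norm_num)
  have h4 := hj 2 (by norm_num) (by norm_num)
  have h4' := hj 3 (by norm_num) (by norm_num)
  have h5 := norm_nonneg (dT W p)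
  have h6 := norm_nonneg (dirD v W p)
  have h7 := norm_nonneg (dirD v (dT W) p)
  have hκ0 : 0 ≤ κ := by linarith
  rw [dirD_tanT h.smooth]
  refine (norm_add_le _ _).trans ?_
  have h8 : ‖⟪dT W p, dT W p⟫ • dirD v W p‖ ≤ κ := by
    rw [norm_smul, real_inner_self_eq_norm_sq, norm_pow, norm_norm]
    have : ‖dT W p‖ ^ 2 ≤ 1 := by nlinarith
    nlinarith
  have h9 : ‖(2 * ⟪dT W p, dirD v (dT W) p⟫) • W p‖ ≤ 2 * κ := by
    rw [norm_smul, h.norm_eq p hp, norm_mul, mul_one, Real.norm_of_nonneg zero_le_two]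
    have h10 := norm_inner_le_norm (𝕜 := ℝ) (dT W p) (dirD v (dT W) p)
    have : ‖dT W p‖ * ‖dirD v (dT W) p‖ ≤ 1 * κ := by gcongr <;> linarith
    linarith
  linarith [norm_add_le (⟪dT W p, dT W p⟫ • dirD v W p)
    ((2 * ⟪dT W p, dirD v (dT W) p⟫) • W p)]

end IsCylEpsHarmonic

end Decay

section Estimates

variable {V : Type*} [NormedAddCommGroup V] [InnerProductSpace ℝ V] [CompleteSpace V]

namespace IsCylEpsHarmonic

variable {ε b κ S₀ S₁ : ℝ} {W g : ℝ × ℝ → V}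

/-- Exponential decay of the angular energy of an `ε`-harmonic map on a long cylinder. -/
lemma angular_energy_le (h : IsCylEpsHarmonic ε b W g) (hε : 0 ≤ ε)
    (hεS : ε ≤ Real.exp (2 * S₀)) (hb : S₁ < b) (hκ : κ ≤ 1 / 10)
    (hj : ∀ s ∈ Set.Icc S₀ S₁, ∀ θ ∈ Set.Icc 0 (2 * Real.pi), ∀ j : ℕ, 1 ≤ j → j ≤ 3 →
      ‖iteratedFDeriv ℝ j W (s, θ)‖ ≤ κ) :
    ∀ s ∈ Set.Icc S₀ S₁, angInt (fun p => ⟪dT W p, dT W p⟫) s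
      ≤ 2805 * κ ^ 2 * (Real.exp (-(S₁ - s) / 10) + Real.exp (-(s - S₀) / 10)) := by
  have hW := h.smooth
  have hg := h.smooth_lap
  have hWT : ContDiff ℝ (⊤ : ℕ∞) (dT W) := contDiff_dirD hW
  have hWST : ContDiff ℝ (⊤ : ℕ∞) (dS (dT W)) := contDiff_dirD hWT
  have hWc := hW.continuous
  have hWSc : Continuous (dS W) := (contDiff_dirD hW).continuous
  have hWTc := hWT.continuous
  have hWSTc := hWST.continuous
  have hWTTc : Continuous (dT (dT W)) := (contDiff_dirD hWT).continuous
  have hgSc : Continuous (dS g) := (contDiff_dirD hg).continuous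
  have hgTc : Continuous (dT g) := (contDiff_dirD hg).continuous
  have hτ : ContDiff ℝ (⊤ : ℕ∞) (tanT W) := contDiff_tanT hW
  have hτc := hτ.continuous
  have hτSc : Continuous (dS (tanT W)) := (contDiff_dirD hτ).continuous
  have hτTc : Continuous (dT (tanT W)) := (contDiff_dirD hτ).continuous
  have hpi := Real.pi_pos
  have hpi2 := Real.pi_lt_d2
  have n1 : ‖((1 : ℝ), (0 : ℝ))‖ ≤ 1 := by simp
  have n2 : ‖((0 : ℝ), (1 : ℝ))‖ ≤ 1 := by simp
  have hexp : ∀ s : ℝ, ε * Real.exp (-2 * s) ≤ Real.exp (-2 * (s - S₀)) := fun s => by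
    have e : Real.exp (-2 * (s - S₀)) = Real.exp (2 * S₀) * Real.exp (-2 * s) := by
      rw [← Real.exp_add]; ring_nf
    rw [e]
    gcongr
  have h1 : ∀ s ∈ Set.Icc S₀ S₁, ∀ θ ∈ Set.Icc 0 (2 * Real.pi), ‖dT W (s, θ)‖ ≤ κ :=
    fun s hs θ hθ => (norm_dirD_le hW n2).trans (hj s hs θ hθ 1 le_rfl (by norm_num))
  have h2 : ∀ s ∈ Set.Icc S₀ S₁, ∀ θ ∈ Set.Icc 0 (2 * Real.pi), ‖dS (dT W) (s, θ)‖ ≤ κ :=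
    fun s hs θ hθ => (norm_dirD_dirD_le hW n1 n2).trans (hj s hs θ hθ 2 (by norm_num) (by norm_num))
  have hκ0 : ∀ s ∈ Set.Icc S₀ S₁, 0 ≤ κ := fun s hs =>
    (norm_nonneg _).trans (h1 s hs 0 ⟨le_rfl, by positivity⟩)
  refine decay_of_differential_inequality (sq_nonneg κ)
    (Θ' := angInt fun p => 2 * ⟪dT W p, dS (dT W) p⟫)
    (fun s _ => (hasDerivAt_angInt (hWT.inner ℝ hWT) s).congr_deriv (angInt_congr fun θ => ?_))
    (fun s hs => h.hasDerivAt_angular (hs.2.trans_lt hb)) (fun s hs => ?_) (fun s hs => ?_)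
    (fun s hs => ?_) (fun s hs => ?_)
  · rw [dirD_inner hWT hWT, real_inner_comm (dT W (s, θ)) (dS (dT W) (s, θ))]
    ring
  · have hκs := hκ0 s hs
    have hsb : s < b := hs.2.trans_lt hb
    have hmono := angInt_mono (s := s)
      (F := fun p => 2 * ⟪dT (dT W) p, dT (dT W) p⟫ + ((-4 * κ ^ 2) * ⟪dT W p, dT W p⟫
        + -(64 * κ ^ 2 * (ε * Real.exp (-2 * s)))))
      (G := fun p => 2 * ⟪dS (dT W) p, dS (dT W) p⟫ + 2 * ⟪dT (dT W) p, dT (dT W) p⟫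
        - 2 * ⟪dT W p, dT W p⟫ * (⟪dS W p, dS W p⟫ + ⟪dT W p, dT W p⟫)
        + 2 * ε * (⟪dS (tanT W) p, dS g p⟫ + ⟪dT (tanT W) p, dT g p⟫))
      (by fun_prop) (by fun_prop) (fun θ hθ => ?_)
    · rw [angInt_add (by fun_prop) (by fun_prop), angInt_add (by fun_prop) (by fun_prop),
        angInt_const_mul, angInt_const_mul, angInt_const] at hmono
      have hpoin := angInt_sq_le_of_mean_zero hWT (angInt_dirD_snd hW h.periodic s)
      simp only [← real_inner_self_eq_norm_sq] at hpoin
      have hTT : 0 ≤ angInt (fun p => ⟪dT (dT W) p, dT (dT W) p⟫) s := by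
        have := angInt_mono (s := s) (F := fun _ => 0)
          (G := fun p => ⟪dT (dT W) p, dT (dT W) p⟫) (by fun_prop) (by fun_prop)
          (fun θ _ => real_inner_self_nonneg)
        simpa [angInt_const] using this
      have hT : 0 ≤ angInt (fun p => ⟪dT W p, dT W p⟫) s := by
        have := angInt_mono (s := s) (F := fun _ => 0)
          (G := fun p => ⟪dT W p, dT W p⟫) (by fun_prop) (by fun_prop)
          (fun θ _ => real_inner_self_nonneg)
        simpa [angInt_const] using this
      have h3 : angInt (fun p => ⟪dT W p, dT W p⟫) s
          ≤ 40 * angInt (fun p => ⟪dT (dT W) p, dT (dT W) p⟫) s :=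
        hpoin.trans (mul_le_mul_of_nonneg_right (by nlinarith) hTT)
      have h4 : κ ^ 2 * angInt (fun p => ⟪dT W p, dT W p⟫) s
          ≤ (1 / 100) * angInt (fun p => ⟪dT W p, dT W p⟫) s :=
        mul_le_mul_of_nonneg_right (by nlinarith) hT
      have h5 : κ ^ 2 * (ε * Real.exp (-2 * s)) * (2 * Real.pi)
          ≤ κ ^ 2 * Real.exp (-2 * (s - S₀)) * (2 * 3.15) := by
        gcongr
        exact hexp s
      have h6 : 0 ≤ κ ^ 2 * Real.exp (-2 * (s - S₀)) := by positivity
      rw [smul_eq_mul] at hmono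
      linarith
    · have hjp := hj s hs θ hθ
      have a1 : ‖dS W (s, θ)‖ ≤ κ := (norm_dirD_le hW n1).trans (hjp 1 le_rfl (by norm_num))
      have a2 := h1 s hs θ hθ
      have a3 := (abs_le.mp (abs_inner_le_mul
        (h.norm_dirD_tanT_le (p := (s, θ)) hsb (by linarith) hjp n1)
        (h.norm_axial_lap_le hjp))).1
      have a4 := (abs_le.mp (abs_inner_le_mul
        (h.norm_dirD_tanT_le (p := (s, θ)) hsb (by linarith) hjp n2)
        (h.norm_angular_lap_le hjp))).1
      have a5 : ⟪dS W (s, θ), dS W (s, θ)⟫ + ⟪dT W (s, θ), dT W (s, θ)⟫ ≤ 2 * κ ^ 2 := by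
        rw [real_inner_self_eq_norm_sq, real_inner_self_eq_norm_sq]
        nlinarith [norm_nonneg (dS W (s, θ)), norm_nonneg (dT W (s, θ))]
      have a6 := mul_le_mul_of_nonneg_left a5 (real_inner_self_nonneg (x := dT W (s, θ)))
      have a7 : 0 ≤ ⟪dS (dT W) (s, θ), dS (dT W) (s, θ)⟫ := real_inner_self_nonneg
      have a8 := mul_le_mul_of_nonneg_left (add_le_add a3 a4) hε
      simp only at a8 ⊢
      linarith
  · rw [angInt_add (by fun_prop) (by fun_prop), add_sub_cancel_left, angInt_const_mul, abs_mul,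
      abs_of_nonneg (by positivity)]
    have hκs := hκ0 s hs
    have h3 := norm_angInt_le (F := fun p => ⟪tanT W p, dS g p⟫) (s := s)
      (C := 2 * κ * (6 * κ * Real.exp (-2 * s))) (fun θ hθ => abs_inner_le_mul
        (h.norm_tanT_le (p := (s, θ)) (hs.2.trans_lt hb) (by linarith) (hj s hs θ hθ))
        (h.norm_axial_lap_le (hj s hs θ hθ)))
    rw [Real.norm_eq_abs] at h3
    calc 2 * ε * |angInt (fun p => ⟪tanT W p, dS g p⟫) s|
        ≤ 2 * ε * (2 * Real.pi * (2 * κ * (6 * κ * Real.exp (-2 * s)))) := by gcongr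
      _ = 48 * Real.pi * κ ^ 2 * (ε * Real.exp (-2 * s)) := by ring
      _ ≤ 160 * κ ^ 2 * Real.exp (-2 * (s - S₀)) := by
          gcongr
          · linarith
          · exact hexp s
  · have h3 := norm_angInt_le (F := fun p => ⟪dT W p, dT W p⟫) (s := s)
      (C := κ * κ) (fun θ hθ => abs_inner_le_mul (h1 s hs θ hθ) (h1 s hs θ hθ))
    have h4 := le_abs_self (angInt (fun p => ⟪dT W p, dT W p⟫) s)
    rw [Real.norm_eq_abs] at h3
    nlinarith [sq_nonneg κ]
  · have h3 := norm_angInt_le (F := fun p => ⟪dT W p, dS (dT W) p⟫) (s := s)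
      (C := κ * κ) (fun θ hθ => abs_inner_le_mul (h1 s hs θ hθ) (h2 s hs θ hθ))
    rw [angInt_const_mul, abs_mul, abs_two]
    rw [Real.norm_eq_abs] at h3
    nlinarith [sq_nonneg κ]

/-- Comparison of the axial and the angular energy through the Pohozaev identity. -/
lemma axial_energy_le (h : IsCylEpsHarmonic ε b W g) (hε : 0 ≤ ε) (hb : S₁ < b)
    (hκ : κ ≤ 1 / 10)
    (hj : ∀ s ∈ Set.Icc S₀ S₁, ∀ θ ∈ Set.Icc 0 (2 * Real.pi), ∀ j : ℕ, 1 ≤ j → j ≤ 3 →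
      ‖iteratedFDeriv ℝ j W (s, θ)‖ ≤ κ) {M : ℝ} (hM : ∀ s ≤ S₀, ∀ θ, ‖g (s, θ)‖ ≤ M)
    (hlim : Tendsto (angInt (pohozaevDensity ε W g)) atBot (nhds 0)) :
    ∀ s ∈ Set.Icc S₀ S₁, angInt (fun p => ⟪dS W p, dS W p⟫) s
      ≤ angInt (fun p => ⟪dT W p, dT W p⟫) s
        + 20 * (ε * (M ^ 2 * Real.exp (2 * S₀) + Real.exp (-2 * S₀))) := by
  intro s hs
  have hW := h.smooth
  have hg := h.smooth_lap
  have hgc := hg.continuous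
  have hWSc : Continuous (dS W) := (contDiff_dirD hW).continuous
  have hWTc : Continuous (dT W) := (contDiff_dirD hW).continuous
  have hWSSc : Continuous (dS (dS W)) := (contDiff_dirD (contDiff_dirD hW)).continuous
  have hgSc : Continuous (dS g) := (contDiff_dirD hg).continuous
  have hpi := Real.pi_pos
  have hpi2 := Real.pi_lt_d2
  have n1 : ‖((1 : ℝ), (0 : ℝ))‖ ≤ 1 := by simp
  have h1 : ∀ s ∈ Set.Icc S₀ S₁, ∀ θ ∈ Set.Icc 0 (2 * Real.pi), ‖dS W (s, θ)‖ ≤ κ :=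
    fun s hs θ hθ => (norm_dirD_le hW n1).trans (hj s hs θ hθ 1 le_rfl (by norm_num))
  have h2 : ∀ s ∈ Set.Icc S₀ S₁, ∀ θ ∈ Set.Icc 0 (2 * Real.pi), ‖dS (dS W) (s, θ)‖ ≤ κ :=
    fun s hs θ hθ => (norm_dirD_dirD_le hW n1 n1).trans (hj s hs θ hθ 2 (by norm_num) (by norm_num))
  have hκ0 : 0 ≤ κ := (norm_nonneg _).trans (h1 s hs 0 ⟨le_rfl, by positivity⟩)
  have hS : S₀ ≤ S₁ := hs.1.trans hs.2
  have hexp : ∀ c s : ℝ, HasDerivAt (fun x => Real.exp (c * x)) (Real.exp (c * s) * c) s :=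
    fun c s => by simpa using ((hasDerivAt_id s).const_mul c).exp
  have hgrow : ∀ s θ : ℝ, ∀ c : ℝ, ‖g (s, θ)‖ ≤ c →
      ‖⟪Real.exp (2 * s) • g (s, θ), g (s, θ)⟫‖ ≤ Real.exp (2 * s) * c ^ 2 := fun s θ c hc => by
    rw [real_inner_smul_left, norm_mul, Real.norm_of_nonneg (Real.exp_pos _).le,
      real_inner_self_eq_norm_sq, norm_pow, norm_norm]
    gcongr
  have hcan : ∀ s : ℝ, Real.exp (2 * s) * Real.exp (-2 * s) = 1 := fun s => by
    rw [← Real.exp_add]; simp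
  have hQ0 : angInt (pohozaevDensity ε W g) S₀ ≤ Real.pi * ε * M ^ 2 * Real.exp (2 * S₀) := by
    have hd : ∀ x ∈ Set.Iic S₀, HasDerivAt (fun x => angInt (pohozaevDensity ε W g) x
        - Real.pi * ε * M ^ 2 * Real.exp (2 * x))
        (ε * angInt (fun p => ⟪Real.exp (2 * p.1) • g p, g p⟫) x
          - Real.pi * ε * M ^ 2 * (Real.exp (2 * x) * 2)) x := fun x hx =>
      (h.hasDerivAt_pohozaev ((Set.mem_Iic.mp hx).trans_lt (hS.trans_lt hb))).sub
        ((hexp 2 x).const_mul _)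
    have hanti : AntitoneOn (fun x => angInt (pohozaevDensity ε W g) x
        - Real.pi * ε * M ^ 2 * Real.exp (2 * x)) (Set.Iic S₀) := by
      refine antitoneOn_of_deriv_nonpos (convex_Iic _)
        (fun x hx => (hd x hx).continuousAt.continuousWithinAt)
        (fun x hx => (hd x (interior_subset hx)).differentiableAt.differentiableWithinAt)
        (fun x hx => ?_)
      have hx := interior_subset hx
      rw [(hd x hx).deriv]
      have h3 := norm_angInt_le (F := fun p => ⟪Real.exp (2 * p.1) • g p, g p⟫) (s := x)
        (fun θ _ => hgrow x θ M (hM x hx θ))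
      have h4 := mul_le_mul_of_nonneg_left ((le_abs_self _).trans h3) hε
      linarith
    have hl : Tendsto (fun x => angInt (pohozaevDensity ε W g) x
        - Real.pi * ε * M ^ 2 * Real.exp (2 * x)) atBot (nhds 0) := by
      have h5 : Tendsto (fun x : ℝ => Real.exp (2 * x)) atBot (nhds 0) :=
        Real.tendsto_exp_atBot.comp (tendsto_id.const_mul_atBot zero_lt_two)
      simpa using hlim.sub (h5.const_mul (Real.pi * ε * M ^ 2))
    have := ge_of_tendsto hl (Filter.mem_of_superset (Iic_mem_atBot S₀) fun x hx =>
      hanti hx (Set.mem_Iic.mpr le_rfl) hx)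
    simp only at this
    linarith
  have hQ : angInt (pohozaevDensity ε W g) s ≤ Real.pi * ε * M ^ 2 * Real.exp (2 * S₀)
      + 4 * Real.pi * ε * κ ^ 2 * Real.exp (-2 * S₀) := by
    have hd : ∀ x ∈ Set.Icc S₀ S₁, HasDerivAt (fun x => angInt (pohozaevDensity ε W g) x
        + 4 * Real.pi * ε * κ ^ 2 * Real.exp (-2 * x))
        (ε * angInt (fun p => ⟪Real.exp (2 * p.1) • g p, g p⟫) x
          + 4 * Real.pi * ε * κ ^ 2 * (Real.exp (-2 * x) * -2)) x := fun x hx =>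
      (h.hasDerivAt_pohozaev (hx.2.trans_lt hb)).add ((hexp (-2) x).const_mul _)
    have hanti : AntitoneOn (fun x => angInt (pohozaevDensity ε W g) x
        + 4 * Real.pi * ε * κ ^ 2 * Real.exp (-2 * x)) (Set.Icc S₀ S₁) := by
      refine antitoneOn_of_deriv_nonpos (convex_Icc _ _)
        (fun x hx => (hd x hx).continuousAt.continuousWithinAt)
        (fun x hx => (hd x (interior_subset hx)).differentiableAt.differentiableWithinAt)
        (fun x hx => ?_)
      have hx := interior_subset hx
      rw [(hd x hx).deriv]
      have h3 := norm_angInt_le (F := fun p => ⟪Real.exp (2 * p.1) • g p, g p⟫) (s := x)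
        (fun θ hθ => hgrow x θ (2 * κ * Real.exp (-2 * x)) (h.norm_lap_le (hj x hx θ hθ)))
      have h4 := mul_le_mul_of_nonneg_left ((le_abs_self _).trans h3) hε
      have h5 : Real.exp (2 * x) * (2 * κ * Real.exp (-2 * x)) ^ 2
          = 4 * κ ^ 2 * Real.exp (-2 * x) := by
        linear_combination 4 * κ ^ 2 * Real.exp (-2 * x) * hcan x
      simp only [h5] at h4
      linarith
    have h6 := hanti ⟨le_rfl, hS⟩ hs hs.1
    have h7 : 0 ≤ 4 * Real.pi * ε * κ ^ 2 * Real.exp (-2 * s) := by positivity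
    simp only at h6
    linarith
  have hE : angInt (pohozaevDensity ε W g) s
      = (1 / 2) * (angInt (fun p => ⟪dS W p, dS W p⟫) s
        + (-1) * angInt (fun p => ⟪dT W p, dT W p⟫) s)
      + (-ε) * angInt (fun p => ⟪dS W p, dS g p⟫ + ((-1) * ⟪dS (dS W) p, g p⟫
        + (1 / 2) * ⟪Real.exp (2 * p.1) • g p, g p⟫)) s := by
    unfold pohozaevDensity
    rw [angInt_add (by fun_prop) (by fun_prop), angInt_const_mul, angInt_const_mul,
      angInt_add (by fun_prop) (by fun_prop), angInt_const_mul]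
  have hR : ‖angInt (fun p => ⟪dS W p, dS g p⟫ + ((-1) * ⟪dS (dS W) p, g p⟫
        + (1 / 2) * ⟪Real.exp (2 * p.1) • g p, g p⟫)) s‖
      ≤ 2 * Real.pi * (10 * κ ^ 2 * Real.exp (-2 * s)) := by
    refine norm_angInt_le fun θ hθ => ?_
    have hjp := hj s hs θ hθ
    have a1 := abs_le.mp (abs_inner_le_mul (h1 s hs θ hθ) (h.norm_axial_lap_le hjp))
    have a2 := abs_le.mp (abs_inner_le_mul (h2 s hs θ hθ) (h.norm_lap_le hjp))
    have a3 := abs_le.mp (hgrow s θ _ (h.norm_lap_le hjp))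
    have h5 : Real.exp (2 * s) * (2 * κ * Real.exp (-2 * s)) ^ 2
        = 4 * κ ^ 2 * Real.exp (-2 * s) := by
      linear_combination 4 * κ ^ 2 * Real.exp (-2 * s) * hcan s
    simp only [h5] at a1 a2 a3
    rw [Real.norm_eq_abs, abs_le]
    constructor <;> linarith
  have hR' := mul_le_mul_of_nonneg_left ((le_abs_self _).trans hR) hε
  have hes : Real.exp (-2 * s) ≤ Real.exp (-2 * S₀) := Real.exp_le_exp.mpr (by linarith [hs.1])
  have b1 : ε * κ ^ 2 * Real.exp (-2 * s) * Real.pi ≤ ε * (1 / 100) * Real.exp (-2 * S₀) * 3.15 := by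
    have : κ ^ 2 ≤ 1 / 100 := by nlinarith
    gcongr
  have b2 : ε * κ ^ 2 * Real.exp (-2 * S₀) * Real.pi
      ≤ ε * (1 / 100) * Real.exp (-2 * S₀) * 3.15 := by
    have : κ ^ 2 ≤ 1 / 100 := by nlinarith
    gcongr
  have b3 : ε * M ^ 2 * Real.exp (2 * S₀) * Real.pi ≤ ε * M ^ 2 * Real.exp (2 * S₀) * 3.15 := by
    gcongr
  have b4 : 0 ≤ ε * M ^ 2 * Real.exp (2 * S₀) := by positivity
  have b5 : 0 ≤ ε * Real.exp (-2 * S₀) := by positivity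
  linarith

end IsCylEpsHarmonic

end Estimates

section Oscillation

variable {V : Type*} [NormedAddCommGroup V] [InnerProductSpace ℝ V] [CompleteSpace V]

/-- A slice of a smooth map is close to its mean when the angular derivative is small. -/
lemma norm_two_pi_smul_sub_angInt_le {W : ℝ × ℝ → V} (hW : ContDiff ℝ (⊤ : ℕ∞) W) {s κ : ℝ}
    (h : ∀ θ ∈ Set.Icc 0 (2 * Real.pi), ‖dT W (s, θ)‖ ≤ κ) {θ : ℝ}
    (hθ : θ ∈ Set.Icc 0 (2 * Real.pi)) :
    ‖(2 * Real.pi) • W (s, θ) - angInt W s‖ ≤ 2 * Real.pi * (2 * Real.pi * κ) := by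
  have e : (2 * Real.pi) • W (s, θ) - angInt W s = angInt (fun p => W (s, θ) - W p) s := by
    rw [angInt_sub continuous_const hW.continuous, angInt_const]
  rw [e]
  refine norm_angInt_le fun φ hφ => (norm_sub_slice_le hW hθ hφ).trans ?_
  refine (le_abs_self _).trans ?_
  exact norm_angInt_le (F := fun p => ‖dT W p‖) fun φ hφ => by simpa using h φ hφ

namespace IsCylEpsHarmonic

variable {ε b κ S₀ S₁ : ℝ} {W g : ℝ × ℝ → V}

/-- Oscillation estimate for an `ε`-harmonic map on a long cylinder. -/
lemma oscillation_le (h : IsCylEpsHarmonic ε b W g) (hε : 0 ≤ ε)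
    (hεS : ε ≤ Real.exp (2 * S₀)) (hb : S₁ < b) (hκ : κ ≤ 1 / 10)
    (hj : ∀ s ∈ Set.Icc S₀ S₁, ∀ θ ∈ Set.Icc 0 (2 * Real.pi), ∀ j : ℕ, 1 ≤ j → j ≤ 3 →
      ‖iteratedFDeriv ℝ j W (s, θ)‖ ≤ κ) {M : ℝ} (hM : ∀ s ≤ S₀, ∀ θ, ‖g (s, θ)‖ ≤ M)
    (hlim : Tendsto (angInt (pohozaevDensity ε W g)) atBot (nhds 0)) {s t θ φ : ℝ}
    (hs : s ∈ Set.Icc S₀ S₁) (ht : t ∈ Set.Icc S₀ S₁) (hθ : θ ∈ Set.Icc 0 (2 * Real.pi))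
    (hφ : φ ∈ Set.Icc 0 (2 * Real.pi)) :
    ‖W (t, φ) - W (s, θ)‖ ≤ 910 * κ
      + 2 * (Real.sqrt (ε * (M ^ 2 * Real.exp (2 * S₀) + Real.exp (-2 * S₀))) * (S₁ - S₀)) := by
  wlog hst : s ≤ t generalizing s t θ φ
  · rw [norm_sub_rev]
    exact this ht hs hφ hθ (not_le.mp hst).le
  set E := ε * (M ^ 2 * Real.exp (2 * S₀) + Real.exp (-2 * S₀)) with hEdef
  have hE : 0 ≤ E := by positivity
  have hEs := Real.sqrt_nonneg E
  have hW := h.smooth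
  have hWS : ContDiff ℝ (⊤ : ℕ∞) (dS W) := contDiff_dirD hW
  have hpi := Real.pi_pos
  have hpi2 := Real.pi_lt_d2
  have hpi3 := Real.pi_gt_three
  have h1 : ∀ s ∈ Set.Icc S₀ S₁, ∀ θ ∈ Set.Icc 0 (2 * Real.pi), ‖dT W (s, θ)‖ ≤ κ :=
    fun s hs θ hθ => (norm_dirD_le hW (by simp)).trans (hj s hs θ hθ 1 le_rfl (by norm_num))
  have hκ0 : 0 ≤ κ := (norm_nonneg _).trans (h1 s hs 0 ⟨le_rfl, by positivity⟩)
  have hm : ∀ x ∈ Set.Icc S₀ S₁, ‖angInt (dS W) x‖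
      ≤ 133 * κ * (Real.exp (-(S₁ - x) / 20) + Real.exp (-(x - S₀) / 20))
        + 12 * Real.sqrt E := by
    intro x hx
    have a1 := norm_angInt_le_sqrt hWS.continuous x
    simp only [← real_inner_self_eq_norm_sq (dS W _)] at a1
    have a2 := h.axial_energy_le hε hb hκ hj hM hlim x hx
    have a3 := h.angular_energy_le hε hεS hb hκ hj x hx
    have e1 : Real.exp (-(S₁ - x) / 10) = Real.exp (-(S₁ - x) / 20) ^ 2 := by
      rw [← Real.exp_nat_mul]; push_cast; ring_nf
    have e2 : Real.exp (-(x - S₀) / 10) = Real.exp (-(x - S₀) / 20) ^ 2 := by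
      rw [← Real.exp_nat_mul]; push_cast; ring_nf
    rw [e1, e2] at a3
    set X := Real.exp (-(S₁ - x) / 20)
    set Y := Real.exp (-(x - S₀) / 20)
    have hX : 0 < X := Real.exp_pos _
    have hY : 0 < Y := Real.exp_pos _
    have a4 : angInt (fun p => ⟪dS W p, dS W p⟫) x
        ≤ 2805 * κ ^ 2 * (X ^ 2 + Y ^ 2) + 20 * Real.sqrt E ^ 2 := by
      rw [Real.sq_sqrt hE]
      linarith
    have a5 : ‖angInt (dS W) x‖ ^ 2
        ≤ 2 * 3.15 * (2805 * κ ^ 2 * (X ^ 2 + Y ^ 2) + 20 * Real.sqrt E ^ 2) :=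
      a1.trans ((mul_le_mul_of_nonneg_left a4 (by positivity)).trans (by gcongr))
    refine (pow_le_pow_iff_left₀ (norm_nonneg _) (by positivity) two_ne_zero).mp (a5.trans ?_)
    have p1 : 0 ≤ κ ^ 2 * (X * Y) := by positivity
    have p2 : 0 ≤ κ * (X + Y) * Real.sqrt E := by positivity
    have p3 : 0 ≤ κ ^ 2 * (X ^ 2 + Y ^ 2) := by positivity
    have p4 : 0 ≤ Real.sqrt E ^ 2 := by positivity
    nlinarith
  have hmean : ‖angInt W t - angInt W s‖ ≤ 5320 * κ + 12 * (Real.sqrt E * (S₁ - S₀)) := by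
    set B : ℝ → ℝ := fun x => 2660 * κ * (Real.exp (-(S₁ - x) / 20) - Real.exp (-(x - S₀) / 20))
      + 12 * Real.sqrt E * x with hB
    have hBd : ∀ x, HasDerivAt (fun x => B x - B s)
        (133 * κ * (Real.exp (-(S₁ - x) / 20) + Real.exp (-(x - S₀) / 20))
          + 12 * Real.sqrt E) x := by
      intro x
      have c1 : HasDerivAt (fun x => Real.exp (-(S₁ - x) / 20))
          (Real.exp (-(S₁ - x) / 20) * (1 / 20)) x := by
        simpa using ((((hasDerivAt_id x).const_sub S₁).neg).div_const 20).exp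
      have c2 : HasDerivAt (fun x => Real.exp (-(x - S₀) / 20))
          (Real.exp (-(x - S₀) / 20) * (-1 / 20)) x := by
        simpa using ((((hasDerivAt_id x).sub_const S₀).neg).div_const 20).exp
      refine ((((c1.sub c2).const_mul (2660 * κ)).add
        ((hasDerivAt_id x).const_mul (12 * Real.sqrt E))).sub_const (B s)).congr_deriv ?_
      ring
    have hmd : ∀ x, HasDerivAt (fun x => angInt W x - angInt W s) (angInt (dS W) x) x := fun x =>
      (hasDerivAt_angInt hW x).sub_const _
    have key := image_norm_le_of_norm_deriv_right_le_deriv_boundary' (a := s) (b := t)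
      (fun x _ => (hmd x).continuousAt.continuousWithinAt) (fun x _ => (hmd x).hasDerivWithinAt)
      (by simp) (fun x _ => (hBd x).continuousAt.continuousWithinAt)
      (fun x _ => (hBd x).hasDerivWithinAt)
      (fun x hx => hm x ⟨hs.1.trans hx.1, hx.2.le.trans ht.2⟩) ⟨hst, le_rfl⟩
    refine key.trans ?_
    have le1 : Real.exp (-(S₁ - t) / 20) ≤ 1 := Real.exp_le_one_iff.mpr (by linarith [ht.2])
    have le2 : Real.exp (-(s - S₀) / 20) ≤ 1 := Real.exp_le_one_iff.mpr (by linarith [hs.1])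
    have q1 := mul_le_mul_of_nonneg_left le1 hκ0
    have q2 := mul_le_mul_of_nonneg_left le2 hκ0
    have q3 := mul_nonneg hκ0 (Real.exp_pos (-(t - S₀) / 20)).le
    have q4 := mul_nonneg hκ0 (Real.exp_pos (-(S₁ - s) / 20)).le
    have q5 : Real.sqrt E * (t - s) ≤ Real.sqrt E * (S₁ - S₀) := by
      gcongr
      · exact ht.2
      · exact hs.1
    simp only [hB]
    linarith
  have d1 := norm_two_pi_smul_sub_angInt_le hW (h1 s hs) hθ
  have d2 := norm_two_pi_smul_sub_angInt_le hW (h1 t ht) hφ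
  have d3 : (2 * Real.pi) * ‖W (t, φ) - W (s, θ)‖ ≤ 2 * Real.pi * (2 * Real.pi * κ)
      + (5320 * κ + 12 * (Real.sqrt E * (S₁ - S₀))) + 2 * Real.pi * (2 * Real.pi * κ) := by
    have e : (2 * Real.pi) • (W (t, φ) - W (s, θ)) = ((2 * Real.pi) • W (t, φ) - angInt W t)
        + (angInt W t - angInt W s) - ((2 * Real.pi) • W (s, θ) - angInt W s) := by
      rw [smul_sub]; abel
    have e2 := congrArg norm e
    rw [norm_smul, Real.norm_of_nonneg (by positivity)] at e2
    rw [e2]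
    refine (norm_sub_le _ _).trans (add_le_add ((norm_add_le _ _).trans ?_) d1)
    exact add_le_add d2 hmean
  have hL : 0 ≤ Real.sqrt E * (S₁ - S₀) := mul_nonneg hEs (by linarith [hs.1, hs.2])
  have d4 : 2 * Real.pi * ‖W (t, φ) - W (s, θ)‖ ≤ 2 * Real.pi * (910 * κ
      + 2 * (Real.sqrt E * (S₁ - S₀))) := by
    refine d3.trans ?_
    have f1 : Real.pi * Real.pi * κ ≤ 3.15 * Real.pi * κ := by gcongr
    have f2 : 3 * κ ≤ Real.pi * κ := by gcongr
    have f3 : 3 * (Real.sqrt E * (S₁ - S₀)) ≤ Real.pi * (Real.sqrt E * (S₁ - S₀)) := by gcongr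
    linarith
  exact le_of_mul_le_mul_left d4 (by positivity)

end IsCylEpsHarmonic

end Oscillation

section Plane

variable {l : ℕ}

/-- An `ε`-harmonic map on a disk, read in logarithmic polar coordinates. -/
lemma IsEpsHarmonic.isCylEpsHarmonic {ε ρ : ℝ} (hρ : 0 < ρ) {u : E2 → Eu l}
    (hu : ContDiff ℝ (⊤ : ℕ∞) u) (hsph : ∀ x ∈ Metric.ball (0 : E2) ρ, ‖u x‖ = 1)
    (hharm : IsEpsHarmonic ε (Metric.ball 0 ρ) u) :
    IsCylEpsHarmonic ε (Real.log ρ) (fun p => u (polar p)) (fun p => lap u (polar p)) := by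
  have hmem : ∀ p : ℝ × ℝ, p.1 < Real.log ρ → polar p ∈ Metric.ball (0 : E2) ρ := by
    intro p hp
    rw [mem_ball_zero_iff, norm_polar]
    exact (Real.lt_log_iff_exp_lt hρ).mp hp
  refine ⟨hu.comp contDiff_polar, (contDiff_lap hu).comp contDiff_polar,
    fun s θ => by rw [polar_periodic], fun s θ => by rw [polar_periodic], cyl_laplacian hu,
    fun p hp => hsph _ (hmem p hp), fun p hp => ?_⟩
  obtain ⟨c, hc⟩ := hharm _ (hmem p hp)
  refine ⟨Real.exp (2 * p.1) * c, ?_⟩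
  rw [cyl_laplacian (contDiff_lap hu), mul_smul, ← hc, smul_sub, smul_comm ε]

/-- The Pohozaev quantity of a map that is smooth across the puncture vanishes at the puncture. -/
lemma tendsto_angInt_pohozaevDensity (ε : ℝ) {u : E2 → Eu l} (hu : ContDiff ℝ (⊤ : ℕ∞) u) :
    Tendsto (angInt (pohozaevDensity ε (fun p => u (polar p)) (fun p => lap u (polar p))))
      atBot (nhds 0) := by
  have hL := contDiff_lap hu
  have h1 := (contDiff_euler hu).continuous
  have h2 := (contDiff_rot hu).continuous
  have h3 := (contDiff_euler hL).continuous
  have h4 := (contDiff_euler (contDiff_euler hu)).continuous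
  have h5 := hL.continuous
  have h := angInt_comp_polar_tendsto (Φ := fun x =>
    (1 / 2) * (⟪euler u x, euler u x⟫ + (-1) * ⟪rot u x, rot u x⟫)
      + (-ε) * (⟪euler u x, euler (lap u) x⟫ + ((-1) * ⟪euler (euler u) x, lap u x⟫
        + (1 / 2) * ⟪‖x‖ ^ 2 • lap u x, lap u x⟫))) (by fun_prop) (by simp [euler, rot])
  convert h using 2
  funext p
  have e : Real.exp (2 * p.1) = ‖polar p‖ ^ 2 := by
    rw [norm_polar, ← Real.exp_nat_mul]
    push_cast
    rfl
  rw [pohozaevDensity, dirD_comp_polar_fst hu, dirD_comp_polar_snd hu, dirD_comp_polar_fst hL,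
    dirD_comp_polar_fst (contDiff_euler hu), e]

/-- Oscillation estimate for `ε`-harmonic maps on a neck annulus. -/
lemma exists_neck_oscillation_bound : ∃ C : ℝ, 1 ≤ C ∧ ∀ (l : ℕ) (u : E2 → Eu l)
    (ε κ ρ ρ₀ ρ₁ M : ℝ), ContDiff ℝ (⊤ : ℕ∞) u → (∀ x ∈ Metric.ball (0 : E2) ρ, ‖u x‖ = 1) →
    IsEpsHarmonic ε (Metric.ball 0 ρ) u → 0 ≤ ε → 0 < ρ₀ → ρ₁ < ρ → ε ≤ ρ₀ ^ 2 → 0 ≤ κ →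
    C * κ ≤ 1 / 10 →
    (∀ t ∈ ({1, 2, 3} : Set ℕ), ∀ x : E2, ρ₀ ≤ ‖x‖ → ‖x‖ ≤ ρ₁ →
      ‖iteratedFDeriv ℝ t u x‖ ≤ κ / ‖x‖ ^ t) →
    (∀ x : E2, ‖x‖ ≤ ρ₀ → ‖iteratedFDeriv ℝ 2 u x‖ ≤ M) →
    ∀ x y : E2, ρ₀ ≤ ‖x‖ → ‖x‖ ≤ ρ₁ → ρ₀ ≤ ‖y‖ → ‖y‖ ≤ ρ₁ →
      ‖u x - u y‖ ≤ 910 * (C * κ)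
        + 2 * (Real.sqrt (ε * ((2 * M) ^ 2 * ρ₀ ^ 2 + (ρ₀ ^ 2)⁻¹)) * Real.log (ρ₁ / ρ₀)) := by
  obtain ⟨C, hC1, hC⟩ := exists_comp_polar_bound
  refine ⟨C, hC1, fun l u ε κ ρ ρ₀ ρ₁ M hu hsph hharm hε hρ₀ hρ₁ hερ hκ hCκ hneck hM x y
    hx₀ hx₁ hy₀ hy₁ => ?_⟩
  have hρ₁0 : 0 < ρ₁ := hρ₀.trans_le (hx₀.trans hx₁)
  have hcyl := hharm.isCylEpsHarmonic (hρ₁0.trans hρ₁) hu hsph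
  have hexp : Real.exp (2 * Real.log ρ₀) = ρ₀ ^ 2 := by
    rw [two_mul, Real.exp_add, Real.exp_log hρ₀, sq]
  have hexp' : Real.exp (-2 * Real.log ρ₀) = (ρ₀ ^ 2)⁻¹ := by
    rw [← hexp, ← Real.exp_neg, neg_mul]
  have hmem : ∀ z : E2, ρ₀ ≤ ‖z‖ → ‖z‖ ≤ ρ₁ →
      Real.log ‖z‖ ∈ Set.Icc (Real.log ρ₀) (Real.log ρ₁) := fun z h0 h1 =>
    ⟨Real.log_le_log hρ₀ h0, Real.log_le_log (hρ₀.trans_le h0) h1⟩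
  obtain ⟨θ, hθ, hxθ⟩ := exists_polar (norm_pos_iff.mp (hρ₀.trans_le hx₀))
  obtain ⟨φ, hφ, hyφ⟩ := exists_polar (norm_pos_iff.mp (hρ₀.trans_le hy₀))
  have key := hcyl.oscillation_le (S₀ := Real.log ρ₀) (S₁ := Real.log ρ₁) (κ := C * κ)
    (M := 2 * M) hε (by rwa [hexp]) (Real.log_lt_log hρ₁0 hρ₁) hCκ
    (fun s hs θ hθ => hC l u hu κ s θ hκ hθ fun t ht => hneck t ht _
      (by rw [norm_polar]; exact (Real.log_le_iff_le_exp hρ₀).mp hs.1)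
      (by rw [norm_polar]; exact (Real.le_log_iff_exp_le hρ₁0).mp hs.2))
    (fun s hs θ => (norm_lap_le hu _).trans (mul_le_mul_of_nonneg_left (hM _
      (by rw [norm_polar]; exact (Real.le_log_iff_exp_le hρ₀).mp hs)) zero_le_two))
    (tendsto_angInt_pohozaevDensity ε hu) (hmem y hy₀ hy₁) (hmem x hx₀ hx₁) hφ hθ
  rw [hexp, hexp', ← Real.log_div hρ₁0.ne' hρ₀.ne'] at key
  simpa only [hxθ, hyφ] using key

lemma exists_smooth_extension {u : E2 → Eu l}
    (hu : ContDiffOn ℝ (⊤ : ℕ∞) u (Metric.ball 0 1)) :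
    ∃ w : E2 → Eu l, ContDiff ℝ (⊤ : ℕ∞) w ∧ ∀ x ∈ Metric.ball (0 : E2) (1 / 2), w =ᶠ[nhds x] u := by
  let χ : ContDiffBump (0 : E2) := ⟨1 / 2, 3 / 4, by norm_num, by norm_num⟩
  refine ⟨fun x => χ x • u x, contDiff_iff_contDiffAt.mpr fun x => ?_, fun x hx => ?_⟩
  · by_cases hx : x ∈ Metric.ball (0 : E2) 1
    · exact χ.contDiff.contDiffAt.smul (hu.contDiffAt (Metric.isOpen_ball.mem_nhds hx))
    · have hx' : (3 / 4 : ℝ) < dist x 0 := by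
        rw [Metric.mem_ball, not_lt] at hx
        linarith
      have hev : (fun x => χ x • u x) =ᶠ[nhds x] fun _ => 0 := by
        filter_upwards [(isOpen_lt continuous_const
          (continuous_id.dist continuous_const)).mem_nhds hx'] with z hz
        have hz' : (3 / 4 : ℝ) ≤ dist z 0 := le_of_lt hz
        rw [χ.zero_of_le_dist hz', zero_smul]
      exact contDiffAt_const.congr_of_eventuallyEq hev
  · filter_upwards [Metric.isOpen_ball.mem_nhds hx] with z hz
    rw [χ.one_of_mem_closedBall (Metric.ball_subset_closedBall hz), one_smul]

lemma lap_congr {u w : E2 → Eu l} {x : E2} (h : w =ᶠ[nhds x] u) : lap w =ᶠ[nhds x] lap u := by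
  have hpd : ∀ {f g : E2 → Eu l} (i : Fin 2), f =ᶠ[nhds x] g → pd i f =ᶠ[nhds x] pd i g :=
    fun i hfg => hfg.fderiv.mono fun z hz => by rw [pd, pd, hz]
  filter_upwards [hpd 0 (hpd 0 h), hpd 1 (hpd 1 h)] with z h0 h1
  rw [lap, lap, h0, h1]

lemma IsEpsHarmonic.congr {ε : ℝ} {Ω : Set E2} {u w : E2 → Eu l} (h : IsEpsHarmonic ε Ω u)
    (hw : ∀ x ∈ Ω, w =ᶠ[nhds x] u) : IsEpsHarmonic ε Ω w := by
  intro x hx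
  have h1 := lap_congr (hw x hx)
  rw [h1.eq_of_nhds, (lap_congr h1).eq_of_nhds, (hw x hx).eq_of_nhds]
  exact h x hx

end Plane

section FinalEstimate

variable {l : ℕ}

/-- Uniform convergence of continuous maps on a compact set yields an eventual uniform bound. -/
lemma TendstoUniformlyOn.eventually_norm_le {X F : Type*} [TopologicalSpace X]
    [NormedAddCommGroup F] {v : ℕ → X → F} {f : X → F} {K : Set X} (hK : IsCompact K)
    (hf : ContinuousOn f K) (h : TendstoUniformlyOn v f atTop K) :
    ∃ M : ℝ, ∀ᶠ k in atTop, ∀ y ∈ K, ‖v k y‖ ≤ M := by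
  obtain ⟨M, hM⟩ := hK.exists_bound_of_continuousOn hf
  refine ⟨M + 1, (Metric.tendstoUniformlyOn_iff.1 h 1 one_pos).mono fun k hk y hy => ?_⟩
  have h1 := hk y hy
  rw [dist_eq_norm, norm_sub_rev] at h1
  have h2 := norm_add_le (v k y - f y) (f y)
  rw [sub_add_cancel] at h2
  linarith [hM y hy]

/-- Derivative bounds at the bubble scale, read off from the rescaled map. -/
lemma norm_iteratedFDeriv_le_of_rescale {u w : E2 → Eu l} {r S M ρ : ℝ} (hr : 0 < r) (n : ℕ)
    (hw : ContDiff ℝ (⊤ : ℕ∞) w) (hwu : ∀ x ∈ Metric.ball (0 : E2) ρ, w =ᶠ[nhds x] u)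
    (hS : S * r < ρ)
    (hM : ∀ y ∈ Metric.closedBall (0 : E2) S,
      ‖iteratedFDeriv ℝ n (fun z => u (r • z)) y‖ ≤ M) (x : E2) (hx : ‖x‖ ≤ S * r) :
    ‖iteratedFDeriv ℝ n w x‖ ≤ M / r ^ n := by
  have hy : r⁻¹ • x ∈ Metric.closedBall (0 : E2) S := by
    rw [mem_closedBall_zero_iff, norm_smul, norm_inv, Real.norm_of_nonneg hr.le,
      inv_mul_le_iff₀ hr]
    linarith
  have hxy : r • r⁻¹ • x = x := smul_inv_smul₀ hr.ne' x
  have hev : (fun z => w (r • z)) =ᶠ[nhds (r⁻¹ • x)] fun z => u (r • z) := by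
    have hc : Tendsto (fun z : E2 => r • z) (nhds (r⁻¹ • x)) (nhds x) := by
      have := (continuous_const_smul r).tendsto (r⁻¹ • x)
      rwa [hxy] at this
    exact hc.eventually (hwu x (by rw [mem_ball_zero_iff]; linarith))
  have h := hM _ hy
  rw [← (hev.iteratedFDeriv ℝ n).eq_of_nhds,
    iteratedFDeriv_comp_const_smul r (hw.of_le (mod_cast le_top))] at h
  beta_reduce at h
  rw [hxy, norm_smul, norm_pow, Real.norm_of_nonneg hr.le] at h
  rw [le_div_iff₀ (by positivity)]
  linarith

end FinalEstimate

/-- no-neck property. Under the single-bubble hypotheses, if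
`ν = lim √(ε_k/r_k²) log(1/r_k) = 0`, then the oscillation of `u_k` over the neck annulus
`{Rr_k ≤ |x| ≤ R₀}` tends to `0` in the iterated-limit sense
`lim_{R₀→0} lim_{R→∞} lim_k osc = 0`, stated in ε–δ form. -/
theorem no_neck_property {l : ℕ} (hl : 2 ≤ l)
    (ε : ℕ → ℝ) (hεpos : ∀ k, 0 < ε k) (hε0 : Filter.Tendsto ε Filter.atTop (nhds 0))
    (u : ℕ → E2 → Eu l)
    (hsm : ∀ k, ContDiffOn ℝ (⊤ : ℕ∞) (u k) (Metric.ball 0 1))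
    (hsph : ∀ k, ∀ x ∈ Metric.ball (0 : E2) 1, ‖u k x‖ = 1)
    (hharm : ∀ k, IsEpsHarmonic (ε k) (Metric.ball 0 1) (u k))
    (hbd : ∃ Λ : ℝ, ∀ k, (∫ x in Metric.ball (0 : E2) 1, eDen (ε k) (u k) x) ≤ Λ)
    (r : ℕ → ℝ) (hrpos : ∀ k, 0 < r k) (hr0 : Filter.Tendsto r Filter.atTop (nhds 0))
    (ω : E2 → Eu l) (hω : ContDiff ℝ (⊤ : ℕ∞) ω) (hωnc : ∃ x y : E2, ω x ≠ ω y)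
    (hωE : 0 < ∫ x : E2, ‖lap ω x‖ ^ 2)
    (hωI : MeasureTheory.Integrable (fun x : E2 => ‖lap ω x‖ ^ 2))
    (hconv : ∀ K : Set E2, IsCompact K → ∀ t : ℕ, t ≤ 3 →
      TendstoUniformlyOn (fun k y => iteratedFDeriv ℝ t (fun z => u k ((r k) • z)) y)
        (iteratedFDeriv ℝ t ω) Filter.atTop K)
    (hneck : ∀ δ : ℝ, 0 < δ → ∃ R : ℝ, 1 ≤ R ∧ ∃ R₀ : ℝ, R₀ ∈ Set.Ioo (0 : ℝ) 1 ∧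
      ∃ K : ℕ, ∀ k ≥ K,
        (∀ t ∈ ({1, 2, 3} : Set ℕ), ∀ x : E2, 2 * R * r k ≤ ‖x‖ → ‖x‖ ≤ R₀ / 4 →
          ‖iteratedFDeriv ℝ t (u k) x‖ ≤ Real.sqrt δ / ‖x‖ ^ t) ∧
        (∀ a : ℝ, R * r k < a → a < R₀ / 2 →
          (∫ x in ann a (2 * a), eDen (ε k) (u k) x) ≤ δ))
    (hν : Filter.Tendsto (fun k => Real.sqrt (ε k / (r k) ^ 2) * Real.log (1 / r k))
      Filter.atTop (nhds 0)) :
    ∀ η : ℝ, 0 < η → ∃ R₀' : ℝ, 0 < R₀' ∧ ∀ R₀ : ℝ, 0 < R₀ → R₀ < R₀' →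
      ∃ R' : ℝ, 1 ≤ R' ∧ ∀ R : ℝ, R' ≤ R → ∃ K : ℕ, ∀ k ≥ K,
        ∀ x y : E2, R * r k ≤ ‖x‖ → ‖x‖ ≤ R₀ → R * r k ≤ ‖y‖ → ‖y‖ ≤ R₀ →
          ‖u k x - u k y‖ < η := by
  obtain ⟨C, hC1, hC⟩ := exists_neck_oscillation_bound
  have hC0 : 0 < C := by linarith
  intro η hη
  set κ : ℝ := min (1 / (10 * C)) (η / (2000 * C)) with hκ
  have hκ0 : 0 < κ := by positivity
  have hκ1 : C * κ ≤ 1 / 10 := by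
    calc C * κ ≤ C * (1 / (10 * C)) := by gcongr; exact min_le_left _ _
      _ = 1 / 10 := by field_simp
  have hκ2 : C * κ ≤ η / 2000 := by
    calc C * κ ≤ C * (η / (2000 * C)) := by gcongr; exact min_le_right _ _
      _ = η / 2000 := by field_simp
  obtain ⟨R, hR, ρ, ⟨hρ0, hρ1⟩, K₁, hK₁⟩ := hneck (κ ^ 2) (by positivity)
  rw [Real.sqrt_sq hκ0.le] at hK₁
  refine ⟨ρ / 4, by positivity, fun R₀ _ hR₀ => ⟨2 * R, by linarith, fun R₂ hR₂ => ?_⟩⟩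
  choose w hw hwu using fun k => exists_smooth_extension (hsm k)
  obtain ⟨M, hM⟩ := (hconv _ (isCompact_closedBall 0 (2 * R)) 2 (by norm_num)).eventually_norm_le
    (isCompact_closedBall 0 (2 * R))
    (hω.continuous_iteratedFDeriv (m := 2)
      (WithTop.coe_le_coe.2 (le_top (a := (2 : ℕ∞))))).continuousOn
  set A : ℝ := 16 * M ^ 2 * R ^ 2 + 1 / (4 * R ^ 2) with hA
  have hr1 : ∀ᶠ k in atTop, r k < Real.exp (-1) := hr0.eventually_lt_const (Real.exp_pos _)
  have hr2 : ∀ᶠ k in atTop, r k < 1 / (4 * R) := hr0.eventually_lt_const (by positivity)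
  have hν1 : ∀ᶠ k in atTop, Real.sqrt (ε k / (r k) ^ 2) * Real.log (1 / r k) < 1 :=
    hν.eventually_lt_const one_pos
  have hν2 : ∀ᶠ k in atTop,
      2 * Real.sqrt A * (Real.sqrt (ε k / (r k) ^ 2) * Real.log (1 / r k)) < η / 2 := by
    have := hν.const_mul (2 * Real.sqrt A)
    rw [mul_zero] at this
    exact this.eventually_lt_const (by positivity)
  obtain ⟨K, hK⟩ := eventually_atTop.1
    ((eventually_ge_atTop K₁).and (hM.and (hr1.and (hr2.and (hν1.and hν2)))))
  refine ⟨K, fun k hk x y hx1 hx2 hy1 hy2 => ?_⟩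
  obtain ⟨hkK, hMk, hr1k, hr2k, hν1k, hν2k⟩ := hK k hk
  have hr := hrpos k
  have hlog : 1 ≤ Real.log (1 / r k) := by
    rw [one_div, Real.log_inv]
    have := Real.log_lt_log hr hr1k
    rw [Real.log_exp] at this
    linarith
  have hρr : 2 * R * r k < 1 / 2 := by
    rw [lt_div_iff₀ (by positivity)] at hr2k
    linarith
  have hεr : ε k ≤ (r k) ^ 2 := by
    have h1 : Real.sqrt (ε k / (r k) ^ 2) ≤ 1 := by
      nlinarith [Real.sqrt_nonneg (ε k / (r k) ^ 2)]
    rw [Real.sqrt_le_one, div_le_one (by positivity)] at h1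
    exact h1
  have hinner : 2 * R * r k ≤ R₂ * r k := by gcongr
  have hball : Metric.ball (0 : E2) (1 / 2) ⊆ Metric.ball 0 1 :=
    Metric.ball_subset_ball (by norm_num)
  have hmem : ∀ z : E2, ‖z‖ ≤ R₀ → z ∈ Metric.ball (0 : E2) (1 / 2) := fun z hz => by
    rw [mem_ball_zero_iff]; linarith
  have hest := hC l (w k) (ε k) κ (1 / 2) (2 * R * r k) (ρ / 4) (M / (r k) ^ 2) (hw k)
    (fun z hz => by rw [(hwu k z hz).eq_of_nhds]; exact hsph k z (hball hz))
    (IsEpsHarmonic.congr (fun z hz => hharm k z (hball hz)) (hwu k))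
    (hεpos k).le (by positivity) (by linarith)
    (hεr.trans (by gcongr; nlinarith)) hκ0.le hκ1
    (fun t ht z hz1 hz2 => by
      rw [((hwu k z (by rw [mem_ball_zero_iff]; linarith)).iteratedFDeriv ℝ t).eq_of_nhds]
      exact (hK₁ k hkK).1 t ht z hz1 hz2)
    (norm_iteratedFDeriv_le_of_rescale hr 2 (hw k) (hwu k) hρr hMk)
    x y (hinner.trans hx1) (hx2.trans hR₀.le) (hinner.trans hy1) (hy2.trans hR₀.le)
  rw [(hwu k x (hmem x hx2)).eq_of_nhds, (hwu k y (hmem y hy2)).eq_of_nhds] at hest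
  have hsqrt : Real.sqrt (ε k * ((2 * (M / (r k) ^ 2)) ^ 2 * (2 * R * r k) ^ 2
      + ((2 * R * r k) ^ 2)⁻¹)) = Real.sqrt A * Real.sqrt (ε k / (r k) ^ 2) := by
    rw [← Real.sqrt_mul (by positivity)]
    congr 1
    rw [hA]
    field_simp
    ring
  have hlog' : Real.log (ρ / 4 / (2 * R * r k)) ≤ Real.log (1 / r k) := by
    apply Real.log_le_log (by positivity)
    rw [div_le_div_iff₀ (by positivity) hr]
    nlinarith
  rw [hsqrt] at hest
  have hprod : Real.sqrt A * Real.sqrt (ε k / (r k) ^ 2) * Real.log (ρ / 4 / (2 * R * r k))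
      ≤ Real.sqrt A * Real.sqrt (ε k / (r k) ^ 2) * Real.log (1 / r k) := by gcongr
  linarith

end
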